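/- arXiv:1010.6300 — 7 statements merged into one kernel-verified Lean document; each statement's English description precedes it below -/
import Mathlib

section
/- For all r, r' > 0 with r ≠ r' and every integer k ∈ ℤ, one has K₀(r,r') ≥ K_k(r,r'). -/
open MeasureTheory Real

/-- Legendre function of the second kind:
`Q_ν(t) = ∫_0^{t−√(t²−1)} x^ν/√(x²−2tx+1) dx`. -/
noncomputable def legendreQ (ν t : ℝ) : ℝ :=
  ∫ x in (0:ℝ)..(t - Real.sqrt (t ^ 2 - 1)), x ^ ν / Real.sqrt (x ^ 2 - 2 * t * x + 1)

/-- `e(r) = √(r²+1)`. -/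
noncomputable def ee (r : ℝ) : ℝ := Real.sqrt (r ^ 2 + 1)

/-- `n(r) = √(2e(r)(e(r)+1))`. -/
noncomputable def nn (r : ℝ) : ℝ := Real.sqrt (2 * ee r * (ee r + 1))

/-- `β₁(r,r') = (e(r)+1)(e(r')+1)/(n(r)n(r'))`. -/
noncomputable def beta1 (r r' : ℝ) : ℝ := (ee r + 1) * (ee r' + 1) / (nn r * nn r')

/-- `β₂(r,r') = r r'/(n(r)n(r'))`. -/
noncomputable def beta2 (r r' : ℝ) : ℝ := r * r' / (nn r * nn r')

/-- `ξ = (1/2)(r/r' + r'/r)`. -/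
noncomputable def xiArg (r r' : ℝ) : ℝ := (1/2) * (r / r' + r' / r)

/-- `K₀(r,r') = β₁ Q_{−1/2}(ξ) + β₂ Q_{1/2}(ξ)`. -/
noncomputable def K0 (r r' : ℝ) : ℝ :=
  beta1 r r' * legendreQ (-(1/2)) (xiArg r r') + beta2 r r' * legendreQ (1/2) (xiArg r r')

/-- The critical coupling `δ_c = (Γ(1/4)⁴/(8π²) + 8π²/Γ(1/4)⁴)⁻¹`. -/
noncomputable def deltaC : ℝ :=
  (Real.Gamma (1/4) ^ 4 / (8 * Real.pi ^ 2) + 8 * Real.pi ^ 2 / Real.Gamma (1/4) ^ 4)⁻¹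

/-- The radial form
`b₀[f] = ∫_0^∞ e(r)|f(r)|² dr − (δ/π) Re ∬ f(r) conj(f(r')) K₀(r,r') dr dr'`. -/
noncomputable def b0Form (δ : ℝ) (f : ℝ → ℂ) : ℝ :=
  (∫ r in Set.Ioi (0:ℝ), ee r * ‖f r‖ ^ 2) -
    (δ / Real.pi) *
      (∫ r in Set.Ioi (0:ℝ), ∫ r' in Set.Ioi (0:ℝ),
        f r * (starRingEnd ℂ) (f r') * (K0 r r' : ℂ)).re


/-- The kernels `K_k(r,r')`, `k ∈ ℤ`: for `k ≥ 0`,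
`K_k = β₁ Q_{k−1/2}(ξ) + β₂ Q_{k+1/2}(ξ)`, and for `k < 0`,
`K_k = β₁ Q_{−k−1/2}(ξ) + β₂ Q_{−k−3/2}(ξ)`. -/
noncomputable def Kk (k : ℤ) (r r' : ℝ) : ℝ :=
  if 0 ≤ k then
    beta1 r r' * legendreQ ((k : ℝ) - 1/2) (xiArg r r') +
      beta2 r r' * legendreQ ((k : ℝ) + 1/2) (xiArg r r')
  else
    beta1 r r' * legendreQ (-(k : ℝ) - 1/2) (xiArg r r') +
      beta2 r r' * legendreQ (-(k : ℝ) - 3/2) (xiArg r r')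

theorem legendreQ_integrand_intervalIntegrable {ν t : ℝ} (hν : -(1 / 2) ≤ ν) (ht : 1 < t) :
    IntervalIntegrable (fun x : ℝ => x ^ ν / √(x ^ 2 - 2 * t * x + 1)) volume
      0 (t - √(t ^ 2 - 1)) := by
  have hs : 0 < √(t ^ 2 - 1) := Real.sqrt_pos.2 (by nlinarith)
  have hsq : √(t ^ 2 - 1) ^ 2 = t ^ 2 - 1 := Real.sq_sqrt (by nlinarith)
  set s := √(t ^ 2 - 1)
  have ha : 0 < t - s := by nlinarith
  have ha1 : t - s ≤ 1 := by nlinarith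
  set a := t - s with ha_def
  have hx : IntervalIntegrable (fun x : ℝ => x ^ (-(1 / 2) : ℝ)) volume 0 a :=
    intervalIntegral.intervalIntegrable_rpow' (by norm_num)
  have hax : IntervalIntegrable (fun x : ℝ => (a - x) ^ (-(1 / 2) : ℝ)) volume 0 a := by
    simpa using (hx.comp_sub_left a).symm
  refine ((hx.add hax).const_mul ((√(2 * s) * √a)⁻¹)).mono_fun' ?_ ?_
  · exact Measurable.aestronglyMeasurable (by fun_prop)
  · rw [Set.uIoc_of_le ha.le]
    refine (ae_restrict_iff' measurableSet_Ioc).2 ?_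
    filter_upwards [compl_mem_ae_iff.2 (measure_singleton a)] with x hxa hmem
    have hx0 : 0 < x := hmem.1
    have hxlt : x < a := lt_of_le_of_ne hmem.2 hxa
    have hu : 0 < a - x := sub_pos.2 hxlt
    have hfac : x ^ 2 - 2 * t * x + 1 = (a - x) * (t + s - x) := by
      rw [ha_def]; linear_combination hsq
    have hle : √(a - x) * √(2 * s) ≤ √(x ^ 2 - 2 * t * x + 1) := by
      rw [hfac, Real.sqrt_mul hu.le]
      gcongr
      linarith
    have hpow : x ^ ν ≤ (√x)⁻¹ := by
      rw [Real.sqrt_eq_rpow, ← Real.rpow_neg hx0.le]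
      exact Real.rpow_le_rpow_of_exponent_ge hx0 (by linarith) hν
    have hsum : √a ≤ √x + √(a - x) := by
      refine Real.sqrt_le_iff.2 ⟨by positivity, ?_⟩
      nlinarith [Real.sq_sqrt hx0.le, Real.sq_sqrt hu.le,
        mul_nonneg (Real.sqrt_nonneg x) (Real.sqrt_nonneg (a - x))]
    have hsx : 0 < √x := Real.sqrt_pos.2 hx0
    have hsu : 0 < √(a - x) := Real.sqrt_pos.2 hu
    have hsa : 0 < √a := Real.sqrt_pos.2 ha
    have hss : 0 < √(2 * s) := Real.sqrt_pos.2 (by linarith)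
    rw [Real.norm_of_nonneg (by positivity)]
    simp only [Real.rpow_neg hx0.le, Real.rpow_neg hu.le, ← Real.sqrt_eq_rpow]
    calc x ^ ν / √(x ^ 2 - 2 * t * x + 1) ≤ (√x)⁻¹ / (√(a - x) * √(2 * s)) := by gcongr
      _ = √a / (√x * √(a - x) * (√(2 * s) * √a)) := by field_simp
      _ ≤ (√x + √(a - x)) / (√x * √(a - x) * (√(2 * s) * √a)) := by gcongr
      _ = (√(2 * s) * √a)⁻¹ * ((√x)⁻¹ + (√(a - x))⁻¹) := by field_simp; ring

theorem legendreQ_anti {ν μ t : ℝ} (hν : -(1 / 2) ≤ ν) (hνμ : ν ≤ μ) (ht : 1 < t) :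
    legendreQ μ t ≤ legendreQ ν t := by
  have hs : √(t ^ 2 - 1) ≤ t := Real.sqrt_le_iff.2 ⟨by linarith, by linarith⟩
  have hs1 : t - 1 ≤ √(t ^ 2 - 1) := Real.le_sqrt_of_sq_le (by nlinarith)
  refine intervalIntegral.integral_mono_on_of_le_Ioo (by linarith)
    (legendreQ_integrand_intervalIntegrable (hν.trans hνμ) ht)
    (legendreQ_integrand_intervalIntegrable hν ht) fun x hx => ?_
  gcongr ?_ / _
  exact Real.rpow_le_rpow_of_exponent_ge hx.1 (by linarith [hx.2]) hνμ

theorem one_lt_xiArg {r r' : ℝ} (hr : 0 < r) (hr' : 0 < r') (hne : r ≠ r') :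
    1 < xiArg r r' := by
  have h : xiArg r r' - 1 = (r - r') ^ 2 / (2 * r * r') := by
    unfold xiArg; field_simp; ring
  have : 0 < (r - r') ^ 2 := by
    have := sub_ne_zero.2 hne
    positivity
  have : 0 < (r - r') ^ 2 / (2 * r * r') := by positivity
  linarith

theorem beta2_nonneg {r r' : ℝ} (hr : 0 ≤ r) (hr' : 0 ≤ r') : 0 ≤ beta2 r r' := by
  unfold beta2 nn
  positivity

theorem beta2_le_beta1 {r r' : ℝ} (hr' : 0 ≤ r') : beta2 r r' ≤ beta1 r r' := by
  have h (x : ℝ) : x ≤ ee x + 1 := by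
    have : x ≤ ee x := Real.le_sqrt_of_sq_le (by linarith)
    linarith
  have h0 : 0 ≤ ee r + 1 := by unfold ee; positivity
  unfold beta1 beta2 nn
  gcongr <;> exact h _

theorem K0_ge_Kk (r r' : ℝ) (hr : 0 < r) (hr' : 0 < r') (hne : r ≠ r') (k : ℤ) :
    K0 r r' ≥ Kk k r r' := by
  have ht := one_lt_xiArg hr hr' hne
  have h2 := beta2_nonneg hr.le hr'.le
  have h21 := beta2_le_beta1 (r := r) hr'.le
  unfold K0 Kk
  split_ifs with hk
  · have hk' : (0 : ℝ) ≤ k := by exact_mod_cast hk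
    exact add_le_add
      (mul_le_mul_of_nonneg_left (legendreQ_anti le_rfl (by linarith) ht) (h2.trans h21))
      (mul_le_mul_of_nonneg_left (legendreQ_anti (by norm_num) (by linarith) ht) h2)
  · have hk' : (k : ℝ) ≤ -1 := by exact_mod_cast (by omega : k ≤ -1)
    have hQ : legendreQ (1 / 2) (xiArg r r') ≤ legendreQ (-(1 / 2)) (xiArg r r') :=
      legendreQ_anti le_rfl (by norm_num) ht
    have hQ₁ := mul_le_mul_of_nonneg_left
      (legendreQ_anti (ν := 1 / 2) (μ := -k - 1 / 2) (by norm_num) (by linarith) ht)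
      (h2.trans h21)
    have hQ₂ := mul_le_mul_of_nonneg_left
      (legendreQ_anti (ν := -(1 / 2)) (μ := -k - 3 / 2) le_rfl (by linarith) ht) h2
    linarith [mul_nonneg (sub_nonneg.2 h21) (sub_nonneg.2 hQ)]
end

section
/- For k ∈ {0,1} define h_k(p) := √p·(p²+1)^{−3/4}·Γ(k+3/2)·(1/k!)·((1+y)/(1−y))^{−k/2}·F(−1/2, 3/2; 1+k; (1−y)/2), where y := (p²+1)^{−1/2}. Then for every p > 0, ∫_0^∞ h_k(p')·Q_{k−1/2}((1/2)(p/p' + p'/p)) dp' = π·√p·(p²+1)^{−1/4}·Γ(k+1/2)·(1/k!)·((1+y)/(1−y))^{−k/2}·F(1/2, 1/2; 1+k; (1−y)/2), with y := (p²+1)^{−1/2}. -/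
open MeasureTheory Real

/-- The Pochhammer symbol `(a)_k = a(a+1)⋯(a+k−1)`. -/
noncomputable def poch (a : ℝ) (k : ℕ) : ℝ := ∏ i ∈ Finset.range k, (a + i)

/-- The Gauss hypergeometric series `F(a,b;c;z) = ∑ (a)_k (b)_k / ((c)_k k!) z^k`. -/
noncomputable def Fhyp (a b c z : ℝ) : ℝ :=
  ∑' k : ℕ, poch a k * poch b k / (poch c k * (k.factorial : ℝ)) * z ^ k

/-- The trial functions
`h_k(p) = √p (p²+1)^{−3/4} Γ(k+3/2) (1/k!) ((1+y)/(1−y))^{−k/2} F(−1/2,3/2;1+k;(1−y)/2)`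
with `y = (p²+1)^{−1/2}`. -/
noncomputable def hTrial (k : ℕ) (p : ℝ) : ℝ :=
  Real.sqrt p * (p ^ 2 + 1) ^ (-(3:ℝ)/4) * Real.Gamma ((k : ℝ) + 3/2) *
    (1 / (k.factorial : ℝ)) *
    ((1 + (p ^ 2 + 1) ^ (-(1:ℝ)/2)) / (1 - (p ^ 2 + 1) ^ (-(1:ℝ)/2))) ^ (-(k : ℝ)/2) *
    Fhyp (-(1/2)) (3/2) (1 + (k : ℝ)) ((1 - (p ^ 2 + 1) ^ (-(1:ℝ)/2)) / 2)

theorem poch_succ (a : ℝ) (n : ℕ) : poch a (n + 1) = poch a n * (a + n) := by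
  simp [poch, Finset.prod_range_succ]

theorem poch_pos {a : ℝ} (ha : 0 < a) (n : ℕ) : 0 < poch a n :=
  Finset.prod_pos fun i _ => by positivity

theorem poch_eq_ascPochhammer_eval (a : ℝ) (n : ℕ) : poch a n = (ascPochhammer ℝ n).eval a := by
  induction n with
  | zero => simp [poch]
  | succ n ih => rw [poch_succ, ascPochhammer_succ_eval, ih]

/-- The binomial series of `(1 - x)^(-1/2)`. -/
theorem hasSum_one_div_sqrt_one_sub {x : ℝ} (hx : |x| < 1) :
    HasSum (fun j : ℕ => poch (1/2) j / (j.factorial : ℝ) * x ^ j) (1 / √(1 - x)) := by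
  have h := (Real.one_div_one_sub_rpow_hasFPowerSeriesOnBall_zero (1/2)).hasSum
    (y := x) (by
      rw [Metric.mem_eball, edist_zero_right, ← ofReal_norm, Real.norm_eq_abs]
      simpa using hx)
  rw [Real.sqrt_eq_rpow]
  simp only [zero_add] at h
  refine (congrArg (fun g => HasSum g _) (funext fun j => ?_)).mpr h
  rw [FormalMultilinearSeries.ofScalars_apply_eq, Ring.choose_eq_smul,
    Polynomial.descPochhammer_smeval_eq_ascPochhammer, Polynomial.ascPochhammer_smeval_cast,
    Polynomial.ascPochhammer_smeval_eq_eval, poch_eq_ascPochhammer_eval,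
    show (1/2 + (j:ℝ) - 1 - j + 1) = 1/2 by ring, smul_eq_mul, smul_eq_mul]
  ring

/-- Integration of a power series in `z cos² α` against an even power of `sin`. -/
theorem hasSum_integral_sin_pow_mul_cos_pow {c : ℕ → ℝ} {f : ℝ → ℝ} {z : ℝ} (hz : 0 ≤ z)
    (hf : ∀ x, 0 ≤ x → x ≤ z → HasSum (fun j => c j * x ^ j) (f x)) (k : ℕ) :
    HasSum (fun j => c j * z ^ j * ∫ α in (0:ℝ)..(π/2), sin α ^ (2 * k) * cos α ^ (2 * j))
      (∫ α in (0:ℝ)..(π/2), sin α ^ (2 * k) * f (z * cos α ^ 2)) := by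
  have hs := (hf z hz le_rfl).summable.norm
  have key := intervalIntegral.hasSum_integral_of_dominated_convergence (μ := volume)
    (a := 0) (b := π/2) (F := fun j α => c j * z ^ j * (sin α ^ (2 * k) * cos α ^ (2 * j)))
    (f := fun α => sin α ^ (2 * k) * f (z * cos α ^ 2)) (fun j _ => ‖c j * z ^ j‖)
    (fun j => Continuous.aestronglyMeasurable (by fun_prop))
    (fun j => .of_forall fun α _ => by
      rw [norm_mul]
      refine mul_le_of_le_one_right (norm_nonneg _) ?_
      rw [norm_mul, norm_pow, norm_pow, Real.norm_eq_abs, Real.norm_eq_abs]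
      exact mul_le_one₀ (pow_le_one₀ (abs_nonneg _) (abs_sin_le_one _)) (by positivity)
        (pow_le_one₀ (abs_nonneg _) (abs_cos_le_one _)))
    (.of_forall fun α _ => hs) intervalIntegrable_const
    (.of_forall fun α _ => by
      have hc : cos α ^ 2 ≤ 1 := cos_sq_le_one α
      have h := (hf (z * cos α ^ 2) (by positivity) (by nlinarith)).mul_left (sin α ^ (2 * k))
      refine (congrArg (fun g => HasSum g _) (funext fun j => ?_)).mpr h
      rw [mul_pow, pow_mul (cos α)]
      ring)
  simpa only [intervalIntegral.integral_const_mul] using key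

theorem integral_cos_pow_two_mul (j : ℕ) :
    ∫ α in (0:ℝ)..(π/2), cos α ^ (2 * j) = π / 2 * (poch (1/2) j / (j.factorial : ℝ)) := by
  rw [EulerSine.integral_cos_pow_eq, integral_sin_pow_even]
  have : ∏ i ∈ Finset.range j, (2 * (i : ℝ) + 1) / (2 * i + 2)
      = poch (1/2) j / (j.factorial : ℝ) := by
    induction j with
    | zero => simp [poch]
    | succ n ih =>
      rw [Finset.prod_range_succ, ih, poch_succ, Nat.factorial_succ]
      push_cast
      field_simp
      ring
  rw [this]
  ring

theorem poch_one (j : ℕ) : poch 1 j = (j.factorial : ℝ) := by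
  induction j with
  | zero => simp [poch]
  | succ n ih => rw [poch_succ, ih, Nat.factorial_succ]; push_cast; ring

theorem poch_two (j : ℕ) : poch 2 j = ((j + 1).factorial : ℝ) := by
  induction j with
  | zero => simp [poch]
  | succ n ih => rw [poch_succ, ih, Nat.factorial_succ (n + 1)]; push_cast; ring

theorem integral_sin_pow_mul_cos_pow_two_mul {k : ℕ} (hk : k = 0 ∨ k = 1) (j : ℕ) :
    ∫ α in (0:ℝ)..(π/2), sin α ^ (2 * k) * cos α ^ (2 * j)
      = π / (2 * (k + 1)) * (poch (1/2) j / poch (1 + k) j) := by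
  rcases hk with rfl | rfl
  · simp only [mul_zero, pow_zero, one_mul, integral_cos_pow_two_mul, Nat.cast_zero, add_zero,
      poch_one, zero_add, mul_one]
  · have h : ∀ α : ℝ, sin α ^ (2 * 1) * cos α ^ (2 * j)
        = cos α ^ (2 * j) - cos α ^ (2 * (j + 1)) := fun α => by
      rw [mul_one, sin_sq]; ring
    simp only [h]
    rw [intervalIntegral.integral_sub (Continuous.intervalIntegrable (by fun_prop) _ _)
      (Continuous.intervalIntegrable (by fun_prop) _ _), integral_cos_pow_two_mul,
      integral_cos_pow_two_mul, poch_succ, Nat.cast_one, one_add_one_eq_two, poch_two,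
      Nat.factorial_succ]
    push_cast
    field_simp
    ring

/-- Euler-type integral for `F(a, b; 1 + k; z)` in terms of `F(a, b; 1/2; ·)`. -/
theorem Fhyp_eq_integral {a b z : ℝ} {f : ℝ → ℝ} (hz : 0 ≤ z)
    (hf : ∀ x, 0 ≤ x → x ≤ z →
      HasSum (fun j : ℕ => poch a j * poch b j / (poch (1/2) j * (j.factorial : ℝ)) * x ^ j) (f x))
    {k : ℕ} (hk : k = 0 ∨ k = 1) :
    Fhyp a b (1 + k) z
      = 2 * (k + 1) / π * ∫ α in (0:ℝ)..(π/2), sin α ^ (2 * k) * f (z * cos α ^ 2) := by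
  have h := (hasSum_integral_sin_pow_mul_cos_pow hz hf k).mul_left (2 * (k + 1) / π)
  rw [← h.tsum_eq, Fhyp]
  refine tsum_congr fun j => ?_
  rw [integral_sin_pow_mul_cos_pow_two_mul hk]
  have h1 := (poch_pos (a := 1/2) (by norm_num) j).ne'
  have h2 := (poch_pos (a := 1 + (k:ℝ)) (by positivity) j).ne'
  field_simp

theorem Fhyp_half_half_eq_integral {z : ℝ} (hz : 0 ≤ z) (hz1 : z < 1) {k : ℕ}
    (hk : k = 0 ∨ k = 1) :
    Fhyp (1/2) (1/2) (1 + k) z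
      = 2 * (k + 1) / π *
        ∫ α in (0:ℝ)..(π/2), sin α ^ (2 * k) * (1 / √(1 - z * cos α ^ 2)) := by
  refine Fhyp_eq_integral (f := fun x => 1 / √(1 - x)) hz (fun x hx0 hx => ?_) hk
  convert hasSum_one_div_sqrt_one_sub (x := x) (by rw [abs_of_nonneg hx0]; linarith) using 3 with j
  have h1 := (poch_pos (a := 1/2) (by norm_num) j).ne'
  field_simp

theorem poch_neg_half_mul_poch_three_halves (j : ℕ) :
    poch (-(1/2)) j * poch (3/2) j * (1 - 2 * j) = poch (1/2) j ^ 2 * (1 + 2 * j) := by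
  induction j with
  | zero => simp [poch]
  | succ n ih =>
    simp only [poch_succ]
    push_cast
    have h : (1 - 2 * (n:ℝ)) ≠ 0 := by
      intro h
      have : (1:ℤ) - 2 * n = 0 := by exact_mod_cast h
      omega
    have := eq_div_of_mul_eq h ih
    rw [mul_mul_mul_comm, this]
    field_simp
    ring

theorem hasSum_neg_half_three_halves {x : ℝ} (hx : |x| < 1) :
    HasSum (fun j : ℕ => poch (-(1/2)) j * poch (3/2) j / (poch (1/2) j * (j.factorial : ℝ)) * x ^ j)
      ((1 - 2 * x) / √(1 - x)) := by
  have h := hasSum_one_div_sqrt_one_sub hx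
  have h2 : HasSum (fun j : ℕ => (if j = 0 then 0 else
      poch (1/2) (j - 1) / ((j - 1).factorial : ℝ) * x ^ j)) (x * (1 / √(1 - x))) := by
    rw [← hasSum_nat_add_iff' 1]
    simp only [Nat.add_eq_zero_iff, one_ne_zero, and_false, if_false, Nat.add_sub_cancel,
      Finset.sum_range_one, if_true, sub_zero]
    refine (congrArg (fun g => HasSum g _) (funext fun j => ?_)).mpr (h.mul_left x)
    ring
  have e : (1 - 2 * x) / √(1 - x) = 1 / √(1 - x) - 2 * (x * (1 / √(1 - x))) := by ring
  rw [e]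
  refine (congrArg (fun g => HasSum g _) (funext fun j => ?_)).mpr (h.sub (h2.mul_left 2))
  · have h1 := (poch_pos (a := 1/2) (by norm_num) j).ne'
    have hj : (1 - 2 * (j:ℝ)) ≠ 0 := by
      intro h
      have : (1:ℤ) - 2 * j = 0 := by exact_mod_cast h
      omega
    rw [eq_div_of_mul_eq hj (poch_neg_half_mul_poch_three_halves j)]
    rcases j with _ | n
    · simp [poch]
    · simp only [Nat.add_eq_zero_iff, one_ne_zero, and_false, if_false, Nat.add_sub_cancel,
        Nat.factorial_succ, poch_succ] at *
      have h1' := (poch_pos (a := 1/2) (by norm_num) n).ne'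
      push_cast at *
      have h3 : (1:ℝ) - 2 * (n + 1) ≠ 0 := hj
      have h4 : (1:ℝ) / 2 + n ≠ 0 := by positivity
      field_simp
      ring

theorem Fhyp_neg_half_three_halves_eq_integral {z : ℝ} (hz : 0 ≤ z) (hz1 : z < 1) {k : ℕ}
    (hk : k = 0 ∨ k = 1) :
    Fhyp (-(1/2)) (3/2) (1 + k) z
      = 2 * (k + 1) / π * ∫ α in (0:ℝ)..(π/2),
        sin α ^ (2 * k) * ((1 - 2 * (z * cos α ^ 2)) / √(1 - z * cos α ^ 2)) :=
  Fhyp_eq_integral (f := fun x => (1 - 2 * x) / √(1 - x)) hz (fun x hx0 hx =>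
    hasSum_neg_half_three_halves (by rw [abs_of_nonneg hx0]; linarith)) hk

theorem exists_cos_sq_eq {w : ℝ} (hw : w ∈ Set.Ioo (0:ℝ) 1) :
    ∃ α ∈ Set.Ioo (0:ℝ) (π/2), cos α ^ 2 = w := by
  have h0 : 0 < √w := Real.sqrt_pos.mpr hw.1
  have h1 : √w < 1 := by rw [Real.sqrt_lt' one_pos]; simpa using hw.2
  refine ⟨arccos √w, ⟨arccos_pos.mpr h1, arccos_lt_pi_div_two.mpr h0⟩, ?_⟩
  rw [cos_arccos (by linarith) h1.le, Real.sq_sqrt hw.1.le]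

theorem cos_pos_of_mem {α : ℝ} (hα : α ∈ Set.Ioo (0:ℝ) (π/2)) : 0 < cos α :=
  cos_pos_of_mem_Ioo ⟨by linarith [hα.1, pi_pos], hα.2⟩

theorem sin_pos_of_mem {α : ℝ} (hα : α ∈ Set.Ioo (0:ℝ) (π/2)) : 0 < sin α :=
  sin_pos_of_pos_of_lt_pi hα.1 (by linarith [hα.2, pi_pos])

theorem cos_sq_mem_Ioo {α : ℝ} (hα : α ∈ Set.Ioo (0:ℝ) (π/2)) :
    cos α ^ 2 ∈ Set.Ioo (0:ℝ) 1 := by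
  have h1 := cos_pos_of_mem hα
  have h2 := sin_pos_of_mem hα
  exact ⟨by positivity, by nlinarith [sin_sq_add_cos_sq α, pow_pos h2 2]⟩

section CosSqSubst

variable {G G' W : ℝ → ℝ} {S : Set ℝ}

theorem image_comp_cos_sq
    (hGS : ∀ w ∈ Set.Ioo (0:ℝ) 1, G w ∈ S) (hW : ∀ x ∈ S, W x ∈ Set.Ioo (0:ℝ) 1)
    (hGW : ∀ x ∈ S, G (W x) = x) :
    (fun α => G (cos α ^ 2)) '' Set.Ioo 0 (π/2) = S := by
  ext x
  constructor
  · rintro ⟨α, hα, rfl⟩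
    exact hGS _ (cos_sq_mem_Ioo hα)
  · intro hx
    obtain ⟨α, hα, h⟩ := exists_cos_sq_eq (hW x hx)
    exact ⟨α, hα, by simp only [h, hGW x hx]⟩

theorem injOn_comp_cos_sq (hWG : ∀ w ∈ Set.Ioo (0:ℝ) 1, W (G w) = w) :
    Set.InjOn (fun α => G (cos α ^ 2)) (Set.Ioo 0 (π/2)) := by
  intro a ha b hb h
  have h2 : cos a ^ 2 = cos b ^ 2 := by
    rw [← hWG _ (cos_sq_mem_Ioo ha), ← hWG _ (cos_sq_mem_Ioo hb)]
    exact congrArg W h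
  have h3 : cos a = cos b :=
    (sq_eq_sq₀ (cos_pos_of_mem ha).le (cos_pos_of_mem hb).le).mp h2
  have hpi := pi_pos
  exact injOn_cos ⟨ha.1.le, by linarith [ha.2]⟩ ⟨hb.1.le, by linarith [hb.2]⟩ h3

theorem hasDerivAt_comp_cos_sq (hG : ∀ w ∈ Set.Ioo (0:ℝ) 1, HasDerivAt G (G' w) w)
    {α : ℝ} (hα : α ∈ Set.Ioo (0:ℝ) (π/2)) :
    HasDerivAt (fun α => G (cos α ^ 2)) (-(G' (cos α ^ 2) * (2 * sin α * cos α))) α := by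
  have h := (hG _ (cos_sq_mem_Ioo hα)).comp α ((hasDerivAt_cos α).pow 2)
  exact h.congr_deriv (by push_cast; ring)

theorem abs_deriv_comp_cos_sq {α : ℝ} (hα : α ∈ Set.Ioo (0:ℝ) (π/2)) (d : ℝ) :
    |-(d * (2 * sin α * cos α))| = |d| * (2 * sin α * cos α) := by
  have h1 := cos_pos_of_mem hα
  have h2 := sin_pos_of_mem hα
  rw [abs_neg, abs_mul, abs_of_pos (by positivity : 0 < 2 * sin α * cos α)]

theorem integral_comp_cos_sq (hG : ∀ w ∈ Set.Ioo (0:ℝ) 1, HasDerivAt G (G' w) w)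
    (hGS : ∀ w ∈ Set.Ioo (0:ℝ) 1, G w ∈ S) (hW : ∀ x ∈ S, W x ∈ Set.Ioo (0:ℝ) 1)
    (hGW : ∀ x ∈ S, G (W x) = x) (hWG : ∀ w ∈ Set.Ioo (0:ℝ) 1, W (G w) = w) (f : ℝ → ℝ) :
    ∫ x in S, f x = ∫ α in (0:ℝ)..(π/2),
      |G' (cos α ^ 2)| * (2 * sin α * cos α) * f (G (cos α ^ 2)) := by
  rw [← image_comp_cos_sq hGS hW hGW, integral_image_eq_integral_abs_deriv_smul measurableSet_Ioo
    (fun α hα => (hasDerivAt_comp_cos_sq hG hα).hasDerivWithinAt) (injOn_comp_cos_sq hWG),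
    intervalIntegral.integral_of_le (by positivity), integral_Ioc_eq_integral_Ioo]
  exact setIntegral_congr_fun measurableSet_Ioo fun α hα => by
    simp only [abs_deriv_comp_cos_sq hα, smul_eq_mul]

theorem integrableOn_comp_cos_sq (hG : ∀ w ∈ Set.Ioo (0:ℝ) 1, HasDerivAt G (G' w) w)
    (hGS : ∀ w ∈ Set.Ioo (0:ℝ) 1, G w ∈ S) (hW : ∀ x ∈ S, W x ∈ Set.Ioo (0:ℝ) 1)
    (hGW : ∀ x ∈ S, G (W x) = x) (hWG : ∀ w ∈ Set.Ioo (0:ℝ) 1, W (G w) = w) (f : ℝ → ℝ) :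
    IntegrableOn f S ↔ IntegrableOn
      (fun α => |G' (cos α ^ 2)| * (2 * sin α * cos α) * f (G (cos α ^ 2))) (Set.Ioo 0 (π/2)) := by
  rw [← image_comp_cos_sq hGS hW hGW, integrableOn_image_iff_integrableOn_abs_deriv_smul
    measurableSet_Ioo (fun α hα => (hasDerivAt_comp_cos_sq hG hα).hasDerivWithinAt)
    (injOn_comp_cos_sq hWG)]
  exact integrableOn_congr_fun (fun α hα => by
    simp only [abs_deriv_comp_cos_sq hα, smul_eq_mul]) measurableSet_Ioo

end CosSqSubst

/-- `cosArctan (tan ψ) = cos ψ`. -/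
noncomputable def cosArctan (s : ℝ) : ℝ := 1 / √(1 + s ^ 2)

/-- `tanArccos (cos ψ) = tan ψ`. -/
noncomputable def tanArccos (c : ℝ) : ℝ := √(1 / c ^ 2 - 1)

theorem cosArctan_pos (s : ℝ) : 0 < cosArctan s := by unfold cosArctan; positivity

theorem cosArctan_sq (s : ℝ) : cosArctan s ^ 2 = 1 / (1 + s ^ 2) := by
  rw [cosArctan, div_pow, Real.sq_sqrt (by positivity), one_pow]

theorem cosArctan_le_one (s : ℝ) : cosArctan s ≤ 1 := by
  rw [← sq_le_one_iff₀ (cosArctan_pos s).le, cosArctan_sq]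
  exact div_le_one_of_le₀ (by nlinarith [sq_nonneg s]) (by positivity)

theorem cosArctan_lt_one {s : ℝ} (hs : 0 < s) : cosArctan s < 1 := by
  rw [← sq_lt_one_iff₀ (cosArctan_pos s).le, cosArctan_sq, div_lt_one (by positivity)]
  nlinarith

theorem cosArctan_lt_cosArctan {s t : ℝ} (hs : 0 < s) (ht : 0 < t) :
    cosArctan s < cosArctan t ↔ t < s := by
  rw [← sq_lt_sq₀ (cosArctan_pos s).le (cosArctan_pos t).le, cosArctan_sq, cosArctan_sq,
    div_lt_div_iff_of_pos_left one_pos (by positivity) (by positivity), add_lt_add_iff_left,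
    sq_lt_sq₀ ht.le hs.le]

theorem one_div_sq_sub_one_pos {c : ℝ} (hc : c ∈ Set.Ioo (0:ℝ) 1) : 0 < 1 / c ^ 2 - 1 := by
  have := hc.1
  rw [sub_pos, one_lt_div (by positivity)]
  nlinarith [hc.1, hc.2]

theorem tanArccos_pos {c : ℝ} (hc : c ∈ Set.Ioo (0:ℝ) 1) : 0 < tanArccos c :=
  Real.sqrt_pos.mpr (one_div_sq_sub_one_pos hc)

theorem tanArccos_sq {c : ℝ} (hc : c ∈ Set.Ioo (0:ℝ) 1) : tanArccos c ^ 2 = 1 / c ^ 2 - 1 :=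
  Real.sq_sqrt (one_div_sq_sub_one_pos hc).le

theorem cosArctan_tanArccos {c : ℝ} (hc : c ∈ Set.Ioo (0:ℝ) 1) :
    cosArctan (tanArccos c) = c := by
  rw [← sq_eq_sq₀ (cosArctan_pos _).le hc.1.le, cosArctan_sq, tanArccos_sq hc]
  simp

theorem tanArccos_cosArctan {s : ℝ} (hs : 0 < s) : tanArccos (cosArctan s) = s := by
  rw [tanArccos, cosArctan_sq]
  simp [Real.sqrt_sq hs.le]

theorem hasDerivAt_tanArccos {c : ℝ} (hc : c ∈ Set.Ioo (0:ℝ) 1) :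
    HasDerivAt tanArccos (-(1 / (c ^ 3 * tanArccos c))) c := by
  have h0 := hc.1.ne'
  have h1 : HasDerivAt (fun c : ℝ => 1 / c ^ 2 - 1) (-(2 / c ^ 3)) c := by
    have := ((hasDerivAt_const c (1:ℝ)).div (hasDerivAt_pow 2 c) (pow_ne_zero 2 h0)).sub_const 1
    exact this.congr_deriv (by push_cast; field_simp; ring)
  have h2 : HasDerivAt tanArccos (-(2 / c ^ 3) / (2 * tanArccos c)) c :=
    h1.sqrt (one_div_sq_sub_one_pos hc).ne'
  have := (tanArccos_pos hc).ne'
  exact h2.congr_deriv (by field_simp)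

/-- Substitution `s = tanArccos (C (cos² α))`. -/
theorem integral_comp_tanArccos_cos_sq {C C' W : ℝ → ℝ} {a b : ℝ} (ha : 0 ≤ a) (hb : b ≤ 1)
    (hC : ∀ w ∈ Set.Ioo (0:ℝ) 1, HasDerivAt C (C' w) w)
    (hCS : ∀ w ∈ Set.Ioo (0:ℝ) 1, C w ∈ Set.Ioo a b)
    (hW : ∀ c ∈ Set.Ioo a b, W c ∈ Set.Ioo (0:ℝ) 1)
    (hCW : ∀ c ∈ Set.Ioo a b, C (W c) = c) (hWC : ∀ w ∈ Set.Ioo (0:ℝ) 1, W (C w) = w)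
    {S : Set ℝ} (hS : ∀ s, s ∈ S ↔ 0 < s ∧ cosArctan s ∈ Set.Ioo a b) (f : ℝ → ℝ) :
    ∫ s in S, f s = ∫ α in (0:ℝ)..(π/2),
      |C' (cos α ^ 2)| / (C (cos α ^ 2) ^ 3 * tanArccos (C (cos α ^ 2))) * (2 * sin α * cos α) *
        f (tanArccos (C (cos α ^ 2))) := by
  have hC1 : ∀ c ∈ Set.Ioo a b, c ∈ Set.Ioo (0:ℝ) 1 := fun c hc =>
    ⟨ha.trans_lt hc.1, hc.2.trans_le hb⟩
  have hCS' := fun w hw => hC1 _ (hCS w hw)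
  rw [integral_comp_cos_sq (G := fun w => tanArccos (C w))
    (G' := fun w => -(1 / (C w ^ 3 * tanArccos (C w))) * C' w) (W := fun s => W (cosArctan s))
    (fun w hw => (hasDerivAt_tanArccos (hCS' w hw)).comp w (hC w hw))
    (fun w hw => (hS _).mpr ⟨tanArccos_pos (hCS' w hw), by
      rw [cosArctan_tanArccos (hCS' w hw)]; exact hCS w hw⟩)
    (fun s hs => hW _ ((hS s).mp hs).2)
    (fun s hs => by
      simp only [hCW _ ((hS s).mp hs).2]; exact tanArccos_cosArctan ((hS s).mp hs).1)
    (fun w hw => by simp only [cosArctan_tanArccos (hCS' w hw), hWC w hw])]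
  rw [intervalIntegral.integral_of_le (by positivity), integral_Ioc_eq_integral_Ioo,
    intervalIntegral.integral_of_le (by positivity), integral_Ioc_eq_integral_Ioo]
  refine setIntegral_congr_fun measurableSet_Ioo fun α hα => ?_
  have h := hCS' _ (cos_sq_mem_Ioo hα)
  have h1 := tanArccos_pos h
  have h2 := h.1
  simp only [abs_mul, abs_neg]
  rw [abs_of_pos (by positivity : 0 < 1 / (C (cos α ^ 2) ^ 3 * tanArccos (C (cos α ^ 2))))]
  ring

theorem integral_eq_of_hasDerivAt_sub {f g R : ℝ → ℝ} {a b : ℝ} (hf : Continuous f)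
    (hg : Continuous g) (hR : ∀ x, HasDerivAt R (f x - g x) x) (hab : R a = R b) :
    ∫ x in a..b, f x = ∫ x in a..b, g x := by
  have h := intervalIntegral.integral_eq_sub_of_hasDerivAt (fun x _ => hR x)
    ((hf.sub hg).intervalIntegrable a b)
  rw [intervalIntegral.integral_sub (hf.intervalIntegrable _ _) (hg.intervalIntegrable _ _),
    hab, sub_self] at h
  exact sub_eq_zero.mp h

section

variable {z : ℝ}

theorem one_sub_mul_cos_sq_pos (hz : 0 ≤ z) (hz1 : z < 1) (α : ℝ) : 0 < 1 - z * cos α ^ 2 := by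
  nlinarith [cos_sq_le_one α, sq_nonneg (cos α)]

theorem hasDerivAt_sqrt_one_sub_mul_cos_sq (hz : 0 ≤ z) (hz1 : z < 1) (α : ℝ) :
    HasDerivAt (fun α => √(1 - z * cos α ^ 2))
      (z * sin α * cos α / √(1 - z * cos α ^ 2)) α := by
  have h := ((((hasDerivAt_cos α).pow 2).const_mul z).const_sub 1).sqrt
    (one_sub_mul_cos_sq_pos hz hz1 α).ne'
  have := (Real.sqrt_pos.mpr (one_sub_mul_cos_sq_pos hz hz1 α)).ne'
  exact h.congr_deriv (by
    push_cast
    simp only [Pi.pow_apply]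
    field_simp)

theorem integral_cos_sq_div (hz : 0 ≤ z) (hz1 : z < 1) :
    ∫ α in (0:ℝ)..(π/2),
        (1 - z) * cos α ^ 2 / ((1 - z * cos α ^ 2) * √(1 - z * cos α ^ 2))
      = ∫ α in (0:ℝ)..(π/2), sin α ^ 2 / √(1 - z * cos α ^ 2) := by
  have hpos := one_sub_mul_cos_sq_pos hz hz1
  have hne : ∀ α, √(1 - z * cos α ^ 2) ≠ 0 := fun α => (Real.sqrt_pos.mpr (hpos α)).ne'
  refine integral_eq_of_hasDerivAt_sub
    (R := fun α => sin α * cos α / √(1 - z * cos α ^ 2)) ?_ ?_ (fun α => ?_) (by simp)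
  · exact Continuous.div (by fun_prop) (by fun_prop) fun α => mul_ne_zero (hpos α).ne' (hne α)
  · exact Continuous.div (by fun_prop) (by fun_prop) hne
  · have h := ((hasDerivAt_sin α).mul (hasDerivAt_cos α)).div
      (hasDerivAt_sqrt_one_sub_mul_cos_sq hz hz1 α) (hne α)
    refine h.congr_deriv ?_
    have h1 := hne α
    have h2 := (hpos α).ne'
    have h3 := Real.sq_sqrt (hpos α).le
    simp only [Pi.mul_apply]
    generalize √(1 - z * cos α ^ 2) = D at *
    have hs : sin α ^ 2 = 1 - cos α ^ 2 := sin_sq α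
    rw [← h3] at h2 ⊢
    field_simp
    generalize cos α = c at *
    generalize sin α = s at *
    ring_nf
    simp only [h3, hs]
    ring_nf

theorem two_sub_cos_sq_pos (α : ℝ) : 0 < 2 - cos α ^ 2 := by nlinarith [cos_sq_le_one α]

theorem hasDerivAt_primitive (hz : 0 ≤ z) (hz1 : z < 1) (κ μ α : ℝ) :
    HasDerivAt (fun α => sin α * cos α * √(1 - z * cos α ^ 2) * (κ / (2 - cos α ^ 2) + μ))
      (-(κ * (2 - (3 + 4 * z) * cos α ^ 2 + 6 * z * cos α ^ 4 - z * cos α ^ 6)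
          / (2 - cos α ^ 2) ^ 2
        + μ * (1 - 2 * (1 + z) * cos α ^ 2 + 3 * z * cos α ^ 4)) / √(1 - z * cos α ^ 2)) α := by
  have hpos := one_sub_mul_cos_sq_pos hz hz1 α
  have hne : √(1 - z * cos α ^ 2) ≠ 0 := (Real.sqrt_pos.mpr hpos).ne'
  have h2 := (two_sub_cos_sq_pos α).ne'
  have h := (((hasDerivAt_sin α).mul (hasDerivAt_cos α)).mul
    (hasDerivAt_sqrt_one_sub_mul_cos_sq hz hz1 α)).mul
    (((hasDerivAt_const α κ).div (((hasDerivAt_cos α).pow 2).const_sub 2) h2).add_const μ)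
  refine h.congr_deriv ?_
  simp only [Pi.mul_apply, Pi.div_apply, Pi.pow_apply]
  have h3 := Real.sq_sqrt hpos.le
  generalize √(1 - z * cos α ^ 2) = D at *
  have hs : sin α ^ 2 = 1 - cos α ^ 2 := sin_sq α
  generalize cos α = c at *
  generalize sin α = s at *
  push_cast
  field_simp
  ring_nf
  simp only [h3, hs]
  ring_nf

theorem integral_first_kind_profile (hz : 0 ≤ z) (hz1 : z < 1) :
    ∫ α in (0:ℝ)..(π/2), cos α ^ 2 * (2 + cos α ^ 2 - 4 * z * cos α ^ 2) / (2 - cos α ^ 2) ^ 2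
        / √(1 - z * cos α ^ 2)
      = ∫ α in (0:ℝ)..(π/2), (1 - 2 * (z * cos α ^ 2)) / √(1 - z * cos α ^ 2) := by
  have hne : ∀ α, √(1 - z * cos α ^ 2) ≠ 0 := fun α =>
    (Real.sqrt_pos.mpr (one_sub_mul_cos_sq_pos hz hz1 α)).ne'
  have h2 : ∀ α, (2 - cos α ^ 2) ≠ 0 := fun α => (two_sub_cos_sq_pos α).ne'
  refine integral_eq_of_hasDerivAt_sub
    (Continuous.div (Continuous.div (by fun_prop) (by fun_prop) fun α => pow_ne_zero 2 (h2 α))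
      (by fun_prop) hne) (Continuous.div (by fun_prop) (by fun_prop) hne)
    (fun α => (hasDerivAt_primitive hz hz1 2 0 α).congr_deriv ?_) (by simp)
  have h1 := hne α
  have h2 := h2 α
  generalize √(1 - z * cos α ^ 2) = D at *
  field_simp
  ring

theorem integral_second_kind_profile (hz : 0 ≤ z) (hz1 : z < 1) :
    ∫ α in (0:ℝ)..(π/2), (2 - 3 * cos α ^ 2 + 4 * z * cos α ^ 2) * 2 * (1 - z * cos α ^ 2)
        / (2 - cos α ^ 2) ^ 2 / √(1 - z * cos α ^ 2)
      = 6 * z * ∫ α in (0:ℝ)..(π/2),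
        sin α ^ 2 * ((1 - 2 * (z * cos α ^ 2)) / √(1 - z * cos α ^ 2)) := by
  have hne : ∀ α, √(1 - z * cos α ^ 2) ≠ 0 := fun α =>
    (Real.sqrt_pos.mpr (one_sub_mul_cos_sq_pos hz hz1 α)).ne'
  have h2 : ∀ α, (2 - cos α ^ 2) ≠ 0 := fun α => (two_sub_cos_sq_pos α).ne'
  rw [← intervalIntegral.integral_const_mul]
  refine integral_eq_of_hasDerivAt_sub
    (Continuous.div (Continuous.div (by fun_prop) (by fun_prop) fun α => pow_ne_zero 2 (h2 α))
      (by fun_prop) hne)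
    (continuous_const.mul (Continuous.mul (by fun_prop)
      (Continuous.div (by fun_prop) (by fun_prop) hne)))
    (fun α => (hasDerivAt_primitive hz hz1 (-(2 - 4 * z)) (4 * z) α).congr_deriv ?_) (by simp)
  have h1 := hne α
  have h2 := h2 α
  rw [sin_sq]
  generalize √(1 - z * cos α ^ 2) = D at *
  field_simp
  ring

end

section AbelIntegrals

variable {y z : ℝ}

theorem integral_Ioo_comp_cosArctan {p : ℝ} (hp : 0 < p) (hy : y = cosArctan p)
    (hz : z = (1 - y) / 2) (m : ℝ → ℝ) :
    ∫ s in Set.Ioo 0 p, m (cosArctan s) * √(2 * cosArctan s * (1 + cosArctan s))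
        / √(p ^ 2 - s ^ 2)
      = ∫ α in (0:ℝ)..(π/2), 2 * √y / √(1 - z * cos α ^ 2)
        * m (y * (1 - z * cos α ^ 2) / (y + z * cos α ^ 2)) := by
  have hy0 : 0 < y := hy ▸ cosArctan_pos p
  have hy1 : y < 1 := hy ▸ cosArctan_lt_one hp
  have hz0 : 0 < z := by linarith
  have hz1 : z < 1 := by linarith
  have hyz : 1 = y + 2 * z := by linarith
  have hp2 : p ^ 2 = 1 / y ^ 2 - 1 := by rw [hy, cosArctan_sq]; field_simp; ring
  have hd : ∀ w ∈ Set.Ioo (0:ℝ) 1, 0 < y + z * w := fun w hw => by nlinarith [hw.1, hw.2]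
  have hn : ∀ w ∈ Set.Ioo (0:ℝ) 1, 0 < 1 - z * w := fun w hw => by nlinarith [hw.1, hw.2]
  have hmem : ∀ w ∈ Set.Ioo (0:ℝ) 1, y * (1 - z * w) / (y + z * w) ∈ Set.Ioo y 1 :=
    fun w hw => by
      have := hd w hw
      constructor
      · rw [lt_div_iff₀ this]
        have : 0 < y * z * (1 - w) := mul_pos (mul_pos hy0 hz0) (by linarith [hw.2])
        nlinarith
      · rw [div_lt_one this]
        have : 0 < z * w := mul_pos hz0 hw.1
        nlinarith
  have hWpos : ∀ c ∈ Set.Ioo y 1, 0 < c + y := fun c hc => by linarith [hc.1]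
  rw [integral_comp_tanArccos_cos_sq (a := y) (b := 1)
    (C := fun w => y * (1 - z * w) / (y + z * w))
    (C' := fun w => -(y * z * (1 + y)) / (y + z * w) ^ 2)
    (W := fun c => y / z * (1 - c) / (c + y)) hy0.le le_rfl
    (fun w hw => ?_) hmem (fun c hc => ?_) (fun c hc => ?_) (fun w hw => ?_) (fun s => ?_)]
  · rw [intervalIntegral.integral_of_le (by positivity), integral_Ioc_eq_integral_Ioo,
      intervalIntegral.integral_of_le (by positivity), integral_Ioc_eq_integral_Ioo]
    refine setIntegral_congr_fun measurableSet_Ioo fun α hα => ?_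
    have hw := cos_sq_mem_Ioo hα
    have hS := sin_pos_of_mem hα
    have hCo := cos_pos_of_mem hα
    have hm := hmem _ hw
    have hm' : y * (1 - z * cos α ^ 2) / (y + z * cos α ^ 2) ∈ Set.Ioo (0:ℝ) 1 :=
      ⟨hy0.trans hm.1, hm.2⟩
    have hd := hd _ hw
    have hn := hn _ hw
    simp only [cosArctan_tanArccos hm']
    have hS2 := sin_sq α
    have hC1 : 1 - y * (1 - z * cos α ^ 2) / (y + z * cos α ^ 2)
        = z * cos α ^ 2 * (1 + y) / (y + z * cos α ^ 2) := by
      field_simp; ring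
    have hC2 : y * (1 - z * cos α ^ 2) / (y + z * cos α ^ 2) - y
        = 2 * y * z * sin α ^ 2 / (y + z * cos α ^ 2) := by
      rw [hS2]; field_simp; linear_combination hyz
    have hC3 : y * (1 - z * cos α ^ 2) / (y + z * cos α ^ 2) + y
        = y * (1 + y) / (y + z * cos α ^ 2) := by
      field_simp; ring
    have ht := tanArccos_pos hm'
    have ht2 := tanArccos_sq hm'
    generalize hc : y * (1 - z * cos α ^ 2) / (y + z * cos α ^ 2) = c at *
    have hc0 := hm'.1
    have hc1 := hm'.2
    have hps : p ^ 2 - tanArccos c ^ 2 = (c - y) * (c + y) / (c ^ 2 * y ^ 2) := by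
      rw [hp2, ht2]; field_simp; ring
    have hps0 : 0 < p ^ 2 - tanArccos c ^ 2 := by
      rw [hps, hC2, hC3]; positivity
    have key : |(-(y * z * (1 + y)) / (y + z * cos α ^ 2) ^ 2)| / (c ^ 3 * tanArccos c)
        * (2 * sin α * cos α) * (√(2 * c * (1 + c)) / √(p ^ 2 - tanArccos c ^ 2))
        = 2 * √y / √(1 - z * cos α ^ 2) := by
      rw [← sq_eq_sq₀ (by positivity) (by positivity)]
      simp only [mul_pow, div_pow, sq_abs]
      rw [Real.sq_sqrt (by positivity), Real.sq_sqrt hps0.le, Real.sq_sqrt hy0.le,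
        Real.sq_sqrt hn.le, hps, ht2]
      have e : 1 / c ^ 2 - 1 = (1 - c) * (1 + c) / c ^ 2 := by field_simp; ring
      rw [e, hC1, hC2, hC3]
      have : 0 < 1 + c := by linarith
      rw [hS2] at *
      have h1w : 0 < 1 - cos α ^ 2 := by linarith [hw.2]
      generalize 1 + c = c' at *
      subst c
      field_simp
    rw [← key]; ring
  · have h0 := (hd w hw).ne'
    exact ((((hasDerivAt_id w).const_mul z).const_sub 1).const_mul y |>.div
      (((hasDerivAt_id w).const_mul z).const_add y) h0).congr_deriv (by
        simp only [id]; ring)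
  · have := hWpos c hc
    have h1 : 0 < 1 - c := by linarith [hc.2]
    refine ⟨by positivity, ?_⟩
    rw [div_lt_one this, div_mul_eq_mul_div, div_lt_iff₀ hz0]
    nlinarith [hc.1]
  · have := hWpos c hc
    have h2 : y + z * (y / z * (1 - c) / (c + y)) = y * (1 + y) / (c + y) := by
      field_simp; ring
    simp only [h2]
    field_simp
    ring
  · have := hd w hw
    have h2 : y * (1 - z * w) / (y + z * w) + y = y * (1 + y) / (y + z * w) := by
      field_simp; ring
    simp only [h2]
    field_simp
    ring
  · rw [hy]
    constructor
    · rintro ⟨h1, h2⟩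
      exact ⟨h1, (cosArctan_lt_cosArctan hp h1).mpr h2, cosArctan_lt_one h1⟩
    · rintro ⟨h1, h2, -⟩
      exact ⟨h1, (cosArctan_lt_cosArctan hp h1).mp h2⟩

theorem integral_Ioi_comp_cosArctan {p : ℝ} (hp : 0 < p) (hy : y = cosArctan p)
    (hz : z = (1 - y) / 2) (m : ℝ → ℝ) :
    ∫ u in Set.Ioi p, m (cosArctan u) * √(cosArctan u * (1 - cosArctan u) / 2)
        / √(u ^ 2 - p ^ 2)
      = ∫ α in (0:ℝ)..(π/2), √y / √(1 - z * cos α ^ 2)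
        * m (y * cos α ^ 2 / (2 - cos α ^ 2)) := by
  have hy0 : 0 < y := hy ▸ cosArctan_pos p
  have hy1 : y < 1 := hy ▸ cosArctan_lt_one hp
  have hz0 : 0 < z := by linarith
  have hz1 : z < 1 := by linarith
  have hyz : 1 = y + 2 * z := by linarith
  have hp2 : p ^ 2 = 1 / y ^ 2 - 1 := by rw [hy, cosArctan_sq]; field_simp; ring
  have hd : ∀ w ∈ Set.Ioo (0:ℝ) 1, 0 < 2 - w := fun w hw => by linarith [hw.2]
  have hn : ∀ w ∈ Set.Ioo (0:ℝ) 1, 0 < 1 - z * w := fun w hw => by nlinarith [hw.1, hw.2]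
  have hmem : ∀ w ∈ Set.Ioo (0:ℝ) 1, y * w / (2 - w) ∈ Set.Ioo 0 y :=
    fun w hw => by
      have h1 := hd w hw
      have h2 := hw.1
      refine ⟨by positivity, ?_⟩
      rw [div_lt_iff₀ h1]
      nlinarith [hw.2]
  rw [integral_comp_tanArccos_cos_sq (a := 0) (b := y)
    (C := fun w => y * w / (2 - w))
    (C' := fun w => 2 * y / (2 - w) ^ 2)
    (W := fun c => 2 * c / (y + c)) le_rfl hy1.le
    (fun w hw => ?_) hmem (fun c hc => ?_) (fun c hc => ?_) (fun w hw => ?_) (fun s => ?_)]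
  · rw [intervalIntegral.integral_of_le (by positivity), integral_Ioc_eq_integral_Ioo,
      intervalIntegral.integral_of_le (by positivity), integral_Ioc_eq_integral_Ioo]
    refine setIntegral_congr_fun measurableSet_Ioo fun α hα => ?_
    have hw := cos_sq_mem_Ioo hα
    have hS := sin_pos_of_mem hα
    have hCo := cos_pos_of_mem hα
    have hm := hmem _ hw
    have hm' : y * cos α ^ 2 / (2 - cos α ^ 2) ∈ Set.Ioo (0:ℝ) 1 :=
      ⟨hm.1, hm.2.trans hy1⟩
    have hd := hd _ hw
    have hn := hn _ hw
    simp only [cosArctan_tanArccos hm']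
    have hS2 := sin_sq α
    have hC1 : 1 + y * cos α ^ 2 / (2 - cos α ^ 2)
        = 2 * (1 - z * cos α ^ 2) / (2 - cos α ^ 2) := by
      field_simp; linear_combination (-cos α ^ 2) * hyz
    have hC2 : y ^ 2 - (y * cos α ^ 2 / (2 - cos α ^ 2)) ^ 2
        = 4 * y ^ 2 * sin α ^ 2 / (2 - cos α ^ 2) ^ 2 := by
      rw [hS2]; field_simp; ring
    have ht := tanArccos_pos hm'
    have ht2 := tanArccos_sq hm'
    generalize hc : y * cos α ^ 2 / (2 - cos α ^ 2) = c at *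
    have hc0 := hm'.1
    have hc1 : 0 < 1 - c := by linarith [hm'.2]
    have hps : tanArccos c ^ 2 - p ^ 2 = (y ^ 2 - c ^ 2) / (c ^ 2 * y ^ 2) := by
      rw [hp2, ht2]; field_simp; ring
    have hps0 : 0 < tanArccos c ^ 2 - p ^ 2 := by
      rw [hps, hC2]; positivity
    have key : |2 * y / (2 - cos α ^ 2) ^ 2| / (c ^ 3 * tanArccos c)
        * (2 * sin α * cos α) * (√(c * (1 - c) / 2) / √(tanArccos c ^ 2 - p ^ 2))
        = √y / √(1 - z * cos α ^ 2) := by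
      rw [← sq_eq_sq₀ (by positivity) (by positivity)]
      simp only [mul_pow, div_pow, sq_abs]
      rw [Real.sq_sqrt (by positivity), Real.sq_sqrt hps0.le, Real.sq_sqrt hy0.le,
        Real.sq_sqrt hn.le, hps, ht2]
      have e : 1 / c ^ 2 - 1 = (1 - c) * (1 + c) / c ^ 2 := by field_simp; ring
      rw [e, hC1, hC2]
      rw [hS2] at *
      have h1w : 0 < 1 - cos α ^ 2 := by linarith [hw.2]
      generalize 1 - c = c' at *
      subst c
      field_simp
      ring
    rw [← key]; ring
  · have h0 := (hd w hw).ne'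
    exact (((hasDerivAt_id w).const_mul y).div
      ((hasDerivAt_id w).const_sub 2) h0).congr_deriv (by
        simp only [id]; ring)
  · have h1 := hc.1
    have : 0 < y + c := by linarith
    refine ⟨by positivity, ?_⟩
    rw [div_lt_one this]
    linarith [hc.2]
  · have h1 := hc.1
    have : 0 < y + c := by linarith
    have h2 : 2 - 2 * c / (y + c) = 2 * y / (y + c) := by
      field_simp; ring
    simp only [h2]
    field_simp
  · have := hd w hw
    have h2 : y + y * w / (2 - w) = 2 * y / (2 - w) := by
      field_simp; ring
    simp only [h2]
    field_simp
  · rw [hy]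
    constructor
    · intro h2
      have h1 : 0 < s := hp.trans h2
      exact ⟨h1, cosArctan_pos s, (cosArctan_lt_cosArctan h1 hp).mpr h2⟩
    · rintro ⟨h1, -, h2⟩
      exact (cosArctan_lt_cosArctan h1 hp).mp h2

end AbelIntegrals

theorem hasDerivAt_cosArctan (s : ℝ) : HasDerivAt cosArctan (-(s * cosArctan s ^ 3)) s := by
  have h1 : (0:ℝ) < 1 + s ^ 2 := by positivity
  have h := (hasDerivAt_const s (1:ℝ)).div ((((hasDerivAt_pow 2 s).const_add 1)).sqrt h1.ne')
    (Real.sqrt_pos.mpr h1).ne'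
  refine h.congr_deriv ?_
  have h2 := (Real.sqrt_pos.mpr h1).ne'
  unfold cosArctan
  push_cast
  field_simp
  ring

theorem continuous_cosArctan : Continuous cosArctan :=
  continuous_iff_continuousAt.mpr fun s => (hasDerivAt_cosArctan s).continuousAt

theorem tendsto_cosArctan_atTop : Filter.Tendsto cosArctan Filter.atTop (nhds 0) := by
  unfold cosArctan
  simp only [one_div]
  refine (Filter.Tendsto.comp Real.tendsto_sqrt_atTop ?_).inv_tendsto_atTop
  exact Filter.tendsto_atTop_add_const_left _ _ (Filter.tendsto_pow_atTop two_ne_zero)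

theorem mul_cosArctan_sq (s : ℝ) :
    (s * cosArctan s) ^ 2 = (1 - cosArctan s) * (1 + cosArctan s) := by
  have : (1 - cosArctan s) * (1 + cosArctan s) = 1 - cosArctan s ^ 2 := by ring
  rw [this, mul_pow, cosArctan_sq]; field_simp; ring

theorem cosArctan_eq_rpow (p : ℝ) : (p ^ 2 + 1) ^ (-(1:ℝ) / 2) = cosArctan p := by
  rw [cosArctan, Real.sqrt_eq_rpow, one_div, ← Real.rpow_neg (by positivity), add_comm]
  norm_num

theorem rpow_neg_quarter (p : ℝ) : (p ^ 2 + 1) ^ (-(1:ℝ) / 4) = √(cosArctan p) := by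
  rw [← cosArctan_eq_rpow, Real.sqrt_eq_rpow, ← Real.rpow_mul (by positivity)]
  norm_num

theorem rpow_neg_three_quarters (p : ℝ) :
    (p ^ 2 + 1) ^ (-(3:ℝ) / 4) = cosArctan p * √(cosArctan p) := by
  rw [← rpow_neg_quarter, ← cosArctan_eq_rpow, ← Real.rpow_add (by positivity)]
  norm_num

theorem rpow_neg_half_tan_half {p : ℝ} (hp : 0 < p) :
    ((1 + cosArctan p) / (1 - cosArctan p)) ^ (-(1:ℝ) / 2)
      = (1 - cosArctan p) / (p * cosArctan p) := by
  have h0 := cosArctan_pos p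
  have h1 : 0 < 1 - cosArctan p := by linarith [cosArctan_lt_one hp]
  have h2 : (p * cosArctan p) ^ 2 = (1 - cosArctan p) * (1 + cosArctan p) :=
    mul_cosArctan_sq p
  rw [← sq_eq_sq₀ (by positivity) (by positivity), ← Real.rpow_natCast,
    ← Real.rpow_mul (by positivity), div_pow, h2]
  norm_num
  rw [Real.rpow_neg_one]
  field_simp

/-- With `c = cosArctan s`, the function `√(2c(1+εc))`. -/
noncomputable def halfAngle (ε s : ℝ) : ℝ := √(2 * cosArctan s * (1 + ε * cosArctan s))

/-- Minus the derivative of `halfAngle ε`, when `ε ^ 2 = 1`. -/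
noncomputable def halfAngleRate (ε u : ℝ) : ℝ :=
  (1 + 2 * (ε * cosArctan u)) * cosArctan u * √(cosArctan u * (1 - ε * cosArctan u) / 2)

theorem continuous_halfAngleRate (ε : ℝ) : Continuous (halfAngleRate ε) := by
  have := continuous_cosArctan
  unfold halfAngleRate
  fun_prop

theorem continuous_halfAngle (ε : ℝ) : Continuous (halfAngle ε) := by
  have := continuous_cosArctan
  unfold halfAngle
  fun_prop

theorem neg_one_lt_mul_cosArctan_lt_one {ε s : ℝ} (hε : ε ^ 2 = 1) (hs : 0 < s) :
    -1 < ε * cosArctan s ∧ ε * cosArctan s < 1 := by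
  have h0 := cosArctan_pos s
  have h1 := cosArctan_lt_one hs
  rcases mul_self_eq_one_iff.mp (pow_two ε ▸ hε) with rfl | rfl <;> constructor <;> linarith

theorem hasDerivAt_halfAngle {ε s : ℝ} (hε : ε ^ 2 = 1) (hs : 0 < s) :
    HasDerivAt (halfAngle ε) (-halfAngleRate ε s) s := by
  have h0 := cosArctan_pos s
  obtain ⟨hm, hp⟩ := neg_one_lt_mul_cosArctan_lt_one hε hs
  have hp' : 0 < 1 - ε * cosArctan s := by linarith
  have hm' : 0 < 1 + ε * cosArctan s := by linarith
  have hpos : 0 < 2 * cosArctan s * (1 + ε * cosArctan s) := by positivity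
  have h := (((hasDerivAt_cosArctan s).const_mul 2).mul
    (((hasDerivAt_cosArctan s).const_mul ε).const_add 1)).sqrt hpos.ne'
  refine h.congr_deriv ?_
  have key : √(2 * cosArctan s * (1 + ε * cosArctan s)) *
      √(cosArctan s * (1 - ε * cosArctan s) / 2) = s * cosArctan s ^ 2 := by
    rw [← sq_eq_sq₀ (by positivity) (by positivity), mul_pow, Real.sq_sqrt hpos.le,
      Real.sq_sqrt (by positivity)]
    linear_combination (-cosArctan s ^ 4) * hε - cosArctan s ^ 2 * mul_cosArctan_sq s
  have hne := (Real.sqrt_pos.mpr hpos).ne'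
  simp only [Pi.mul_apply]
  unfold halfAngleRate
  rw [div_eq_iff (mul_ne_zero two_ne_zero hne)]
  linear_combination (2 * (1 + 2 * ε * cosArctan s) * cosArctan s) * key

theorem tendsto_halfAngle_atTop (ε : ℝ) :
    Filter.Tendsto (halfAngle ε) Filter.atTop (nhds 0) := by
  have h : Continuous fun c : ℝ => √(2 * c * (1 + ε * c)) := by fun_prop
  have := (h.tendsto 0).comp tendsto_cosArctan_atTop
  simp only [mul_zero, zero_mul, Real.sqrt_zero] at this
  exact this

theorem integrable_halfAngleRate {ε : ℝ} (hε : ε ^ 2 = 1) : Integrable (halfAngleRate ε) := by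
  have hint : Integrable fun u : ℝ => (1 + ‖u‖ ^ 2) ^ (-(3 / 2 : ℝ) / 2) :=
    integrable_rpow_neg_one_add_norm_sq (by norm_num)
  refine (hint.const_mul 3).mono' (continuous_halfAngleRate ε).aestronglyMeasurable
    (.of_forall fun u => ?_)
  have h0 := cosArctan_pos u
  have hc1 := cosArctan_le_one u
  obtain ⟨hm, hp⟩ : -1 ≤ ε * cosArctan u ∧ ε * cosArctan u ≤ 1 := by
    rcases mul_self_eq_one_iff.mp (pow_two ε ▸ hε) with rfl | rfl <;> constructor <;> linarith
  have e : (1 + ‖u‖ ^ 2) ^ (-(3 / 2 : ℝ) / 2) = cosArctan u * √(cosArctan u) := by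
    rw [Real.norm_eq_abs, sq_abs, ← rpow_neg_three_quarters, add_comm]
    norm_num
  rw [e, halfAngleRate, norm_mul, norm_mul, Real.norm_of_nonneg h0.le,
    Real.norm_of_nonneg (Real.sqrt_nonneg _), mul_assoc]
  have h1 : ‖1 + 2 * (ε * cosArctan u)‖ ≤ 3 := by
    rw [Real.norm_eq_abs, abs_le]; constructor <;> linarith
  have h2 : √(cosArctan u * (1 - ε * cosArctan u) / 2) ≤ √(cosArctan u) :=
    Real.sqrt_le_sqrt (by nlinarith)
  gcongr

theorem integral_Ioi_halfAngleRate {ε s : ℝ} (hε : ε ^ 2 = 1) (hs : 0 < s) :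
    ∫ u in Set.Ioi s, halfAngleRate ε u = halfAngle ε s := by
  have h := integral_Ioi_of_hasDerivAt_of_tendsto (f := fun s => -halfAngle ε s)
    (f' := halfAngleRate ε) (a := s) (m := 0) (continuous_halfAngle ε).neg.continuousWithinAt
    (fun u hu => (hasDerivAt_halfAngle hε (hs.trans hu)).neg.congr_deriv (neg_neg _))
    (integrable_halfAngleRate hε).integrableOn
    (by simpa using (tendsto_halfAngle_atTop ε).neg)
  rw [h]; ring

theorem Gamma_three_halves : Real.Gamma (3 / 2) = √π / 2 := by
  have h := Real.Gamma_add_one (s := 1 / 2) (by norm_num)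
  rw [Real.Gamma_one_half_eq] at h
  norm_num at h
  rw [h]; ring

theorem Gamma_five_halves : Real.Gamma (5 / 2) = 3 * √π / 4 := by
  have h := Real.Gamma_add_one (s := 3 / 2) (by norm_num)
  rw [Gamma_three_halves] at h
  norm_num at h
  rw [h]; ring

theorem hTrial_eq_integral {k : ℕ} (hk : k = 0 ∨ k = 1) {q : ℝ} (hq : 0 < q) :
    hTrial k q = √q / √π / q ^ k *
      ∫ u in Set.Ioi q, u ^ k * halfAngleRate ((-1) ^ k) u / √(u ^ 2 - q ^ 2) := by
  have hy0 := cosArctan_pos q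
  have hy1 := cosArctan_lt_one hq
  have hpi := Real.sqrt_pos.mpr pi_pos
  have hpi2 := Real.sq_sqrt pi_pos.le
  have hF := Fhyp_neg_half_three_halves_eq_integral (z := (1 - cosArctan q) / 2)
    (by linarith) (by linarith) hk
  unfold hTrial
  rw [cosArctan_eq_rpow, rpow_neg_three_quarters, hF]
  have hI := fun m => integral_Ioi_comp_cosArctan hq rfl rfl m
  have h1 := integral_first_kind_profile (z := (1 - cosArctan q) / 2)
    (by linarith) (by linarith)
  have h2 := integral_second_kind_profile (z := (1 - cosArctan q) / 2)
    (by linarith) (by linarith)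
  rcases hk with rfl | rfl
  · have e : ∫ u in Set.Ioi q, u ^ 0 * halfAngleRate ((-1) ^ 0) u / √(u ^ 2 - q ^ 2)
        = cosArctan q * √(cosArctan q) * ∫ α in (0:ℝ)..(π/2),
          (1 - 2 * ((1 - cosArctan q) / 2 * cos α ^ 2)) /
            √(1 - (1 - cosArctan q) / 2 * cos α ^ 2) := by
      rw [← h1, ← intervalIntegral.integral_const_mul]
      refine Eq.trans ?_ ((hI fun c => (1 + 2 * c) * c).trans
        (intervalIntegral.integral_congr fun α _ => ?_))
      · simp [halfAngleRate]
      · have := two_sub_cos_sq_pos α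
        field_simp
        ring
    rw [e]
    simp only [mul_zero, pow_zero, one_mul, Nat.cast_zero, zero_add, neg_zero, zero_div,
      Real.rpow_zero, Gamma_three_halves, Nat.factorial_zero, Nat.cast_one]
    generalize @intervalIntegral ℝ _ _ _ _ _ _ = I
    field_simp
    rw [hpi2]
  · have e : ∫ u in Set.Ioi q, u ^ 1 * halfAngleRate ((-1) ^ 1) u / √(u ^ 2 - q ^ 2)
        = √(cosArctan q) * (6 * ((1 - cosArctan q) / 2) * ∫ α in (0:ℝ)..(π/2),
          sin α ^ 2 * ((1 - 2 * ((1 - cosArctan q) / 2 * cos α ^ 2)) /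
            √(1 - (1 - cosArctan q) / 2 * cos α ^ 2))) := by
      rw [← h2, ← intervalIntegral.integral_const_mul]
      refine Eq.trans ?_ ((hI fun c => (1 - 2 * c) * (1 + c)).trans
        (intervalIntegral.integral_congr fun α _ => ?_))
      · refine setIntegral_congr_fun measurableSet_Ioi fun u hu => ?_
        have hu0 : 0 < u := hq.trans hu
        have hc0 := cosArctan_pos u
        have hc1 : 0 < 1 - cosArctan u := by linarith [cosArctan_lt_one hu0]
        have h3 : u * cosArctan u * √(cosArctan u * (1 + cosArctan u) / 2)
            = (1 + cosArctan u) * √(cosArctan u * (1 - cosArctan u) / 2) := by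
          rw [← sq_eq_sq₀ (by positivity) (by positivity), mul_pow _ √_, mul_pow _ √_,
            mul_cosArctan_sq,
            Real.sq_sqrt (by positivity), Real.sq_sqrt (by positivity)]
          ring
        simp only [halfAngleRate, pow_one, neg_mul, one_mul, mul_neg, sub_neg_eq_add,
          ← sub_eq_add_neg]
        congr 1
        linear_combination (1 - 2 * cosArctan u) * h3
      · have := two_sub_cos_sq_pos α
        field_simp
        ring
    rw [e]
    simp only [mul_one, pow_one, Nat.cast_one, Nat.factorial_one]
    rw [show (1:ℝ) + 3 / 2 = 5 / 2 by norm_num, Gamma_five_halves, rpow_neg_half_tan_half hq]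
    generalize @intervalIntegral ℝ _ _ _ _ _ _ = I
    field_simp
    rw [hpi2]
    ring

theorem Fhyp_half_half_eq_abel_integral {k : ℕ} (hk : k = 0 ∨ k = 1) {p : ℝ} (hp : 0 < p) :
    π * √p * (p ^ 2 + 1) ^ (-(1:ℝ)/4) * Real.Gamma ((k : ℝ) + 1/2) *
        (1 / (k.factorial : ℝ)) *
        ((1 + (p ^ 2 + 1) ^ (-(1:ℝ)/2)) / (1 - (p ^ 2 + 1) ^ (-(1:ℝ)/2))) ^ (-(k : ℝ)/2) *
        Fhyp (1/2) (1/2) (1 + (k : ℝ)) ((1 - (p ^ 2 + 1) ^ (-(1:ℝ)/2)) / 2)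
      = √π * √p / p ^ k *
        ∫ s in Set.Ioo 0 p, s ^ k * halfAngle ((-1) ^ k) s / √(p ^ 2 - s ^ 2) := by
  have hy0 := cosArctan_pos p
  have hy1 := cosArctan_lt_one hp
  have hpi := Real.sqrt_pos.mpr pi_pos
  have hpi2 := Real.sq_sqrt pi_pos.le
  have hF := Fhyp_half_half_eq_integral (z := (1 - cosArctan p) / 2)
    (by linarith) (by linarith) hk
  rw [cosArctan_eq_rpow, rpow_neg_quarter, hF]
  have hI := fun m => integral_Ioo_comp_cosArctan hp rfl rfl m
  have h2 := integral_cos_sq_div (z := (1 - cosArctan p) / 2) (by linarith) (by linarith)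
  have hpos := one_sub_mul_cos_sq_pos (z := (1 - cosArctan p) / 2) (by linarith) (by linarith)
  rcases hk with rfl | rfl
  · have e : ∫ s in Set.Ioo 0 p, s ^ 0 * halfAngle ((-1) ^ 0) s / √(p ^ 2 - s ^ 2)
        = 2 * √(cosArctan p) * ∫ α in (0:ℝ)..(π/2),
          1 / √(1 - (1 - cosArctan p) / 2 * cos α ^ 2) := by
      rw [← intervalIntegral.integral_const_mul]
      refine Eq.trans ?_ ((hI fun c => 1).trans
        (intervalIntegral.integral_congr fun α _ => ?_))
      · simp [halfAngle]
      · ring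
    rw [e]
    simp only [mul_zero, pow_zero, one_mul, Nat.cast_zero, zero_add, neg_zero, zero_div,
      Real.rpow_zero, Real.Gamma_one_half_eq, Nat.factorial_zero, Nat.cast_one]
    generalize @intervalIntegral ℝ _ _ _ _ _ _ = I
    field_simp
  · have e : ∫ s in Set.Ioo 0 p, s ^ 1 * halfAngle ((-1) ^ 1) s / √(p ^ 2 - s ^ 2)
        = 2 * √(cosArctan p) * ((1 - cosArctan p) / cosArctan p) * ∫ α in (0:ℝ)..(π/2),
          sin α ^ 2 / √(1 - (1 - cosArctan p) / 2 * cos α ^ 2) := by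
      rw [← h2, ← intervalIntegral.integral_const_mul]
      refine Eq.trans ?_ ((hI fun c => (1 - c) / c).trans
        (intervalIntegral.integral_congr fun α _ => ?_))
      · refine setIntegral_congr_fun measurableSet_Ioo fun u hu => ?_
        have hu0 : 0 < u := hu.1
        have hc0 := cosArctan_pos u
        have hc1 : 0 < 1 - cosArctan u := by linarith [cosArctan_lt_one hu0]
        have h3 : u * cosArctan u * √(2 * cosArctan u * (1 - cosArctan u))
            = (1 - cosArctan u) * √(2 * cosArctan u * (1 + cosArctan u)) := by
          rw [← sq_eq_sq₀ (by positivity) (by positivity), mul_pow _ √_, mul_pow _ √_,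
            mul_cosArctan_sq,
            Real.sq_sqrt (by positivity), Real.sq_sqrt (by positivity)]
          ring
        simp only [halfAngle, pow_one, neg_mul, one_mul, ← sub_eq_add_neg]
        congr 1
        rw [div_mul_eq_mul_div, eq_div_iff hc0.ne']
        linear_combination h3
      · have h4 := hpos α
        have h5 := Real.sqrt_pos.mpr h4
        have h6 : 0 < cosArctan p + (1 - cosArctan p) / 2 * cos α ^ 2 := by
          have : 0 < 1 - cosArctan p := by linarith
          positivity
        have h7 : 1 - cosArctan p * (1 - (1 - cosArctan p) / 2 * cos α ^ 2) /
              (cosArctan p + (1 - cosArctan p) / 2 * cos α ^ 2)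
            = (1 - cosArctan p) / 2 * cos α ^ 2 * (1 + cosArctan p) /
              (cosArctan p + (1 - cosArctan p) / 2 * cos α ^ 2) := by
          rw [eq_div_iff h6.ne', sub_mul, div_mul_cancel₀ _ h6.ne']; ring
        simp only [h7]
        generalize hD : 1 - (1 - cosArctan p) / 2 * cos α ^ 2 = D at *
        generalize hE : cosArctan p + (1 - cosArctan p) / 2 * cos α ^ 2 = E at *
        field_simp
        ring
    rw [e]
    simp only [mul_one, mul_one_div, pow_one, Nat.cast_one, Nat.factorial_one]
    rw [show (1:ℝ) + 1 / 2 = 3 / 2 by norm_num, Gamma_three_halves, rpow_neg_half_tan_half hp]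
    generalize @intervalIntegral ℝ _ _ _ _ _ _ = I
    field_simp
    ring

theorem half_add_div_sub_sqrt {p q : ℝ} (hp : 0 < p) (hq : 0 < q) :
    1 / 2 * (p / q + q / p) - √((1 / 2 * (p / q + q / p)) ^ 2 - 1) = min p q ^ 2 / (p * q) := by
  have h : (1 / 2 * (p / q + q / p)) ^ 2 - 1 = (1 / 2 * (p / q - q / p)) ^ 2 := by
    field_simp; ring
  have h2 : p / q - q / p = (p - q) * (p + q) / (p * q) := by field_simp; ring
  rw [h, Real.sqrt_sq_eq_abs, h2]
  rcases le_total p q with hpq | hpq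
  · rw [min_eq_left hpq, abs_of_nonpos]
    · field_simp; ring
    · have : 0 ≤ q - p := by linarith
      have h3 : 1 / 2 * ((p - q) * (p + q) / (p * q))
          = -(1 / 2 * ((q - p) * (p + q) / (p * q))) := by ring
      rw [h3, neg_nonpos]; positivity
  · rw [min_eq_right hpq, abs_of_nonneg]
    · field_simp; ring
    · have : 0 ≤ p - q := by linarith
      positivity

theorem legendreQ_eq_integral (k : ℕ) {p q : ℝ} (hp : 0 < p) (hq : 0 < q) :
    legendreQ ((k : ℝ) - 1 / 2) (1 / 2 * (p / q + q / p)) = 2 * √(p * q) / (p * q) ^ k *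
      ∫ s in Set.Ioo 0 (min p q), s ^ (2 * k) / (√(p ^ 2 - s ^ 2) * √(q ^ 2 - s ^ 2)) := by
  have hm : 0 < min p q := lt_min hp hq
  have hpq : 0 < p * q := mul_pos hp hq
  rw [legendreQ, half_add_div_sub_sqrt hp hq, intervalIntegral.integral_of_le (by positivity),
    integral_Ioc_eq_integral_Ioo]
  have himg : (fun s => s ^ 2 / (p * q)) '' Set.Ioo 0 (min p q)
      = Set.Ioo 0 (min p q ^ 2 / (p * q)) := by
    ext x
    constructor
    · rintro ⟨s, hs, rfl⟩
      have := hs.1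
      exact ⟨by positivity, by dsimp only; gcongr; exact hs.2⟩
    · rintro ⟨h0, h1⟩
      have h2 : √(p * q * x) ^ 2 = p * q * x := Real.sq_sqrt (by positivity)
      refine ⟨√(p * q * x), ⟨Real.sqrt_pos.mpr (by positivity), ?_⟩, ?_⟩
      · rw [Real.sqrt_lt' hm]
        rw [lt_div_iff₀ hpq] at h1
        linarith
      · simp only [h2]; field_simp
  have hinj : Set.InjOn (fun s => s ^ 2 / (p * q)) (Set.Ioo 0 (min p q)) := by
    intro a ha b hb h
    have h2 : a ^ 2 = b ^ 2 := (div_left_inj' hpq.ne').mp h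
    exact (sq_eq_sq₀ ha.1.le hb.1.le).mp h2
  rw [← himg, integral_image_eq_integral_abs_deriv_smul measurableSet_Ioo
    (f' := fun s => 2 * s / (p * q))
    (fun s _ => (((hasDerivAt_pow 2 s).div_const (p * q)).congr_deriv
      (by push_cast; ring)).hasDerivWithinAt) hinj, ← integral_const_mul]
  refine setIntegral_congr_fun measurableSet_Ioo fun s hs => ?_
  have hs0 := hs.1
  have hsp : 0 < p ^ 2 - s ^ 2 := by nlinarith [lt_min_iff.mp hs.2]
  have hsq : 0 < q ^ 2 - s ^ 2 := by nlinarith [lt_min_iff.mp hs.2]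
  have h1 : (s ^ 2 / (p * q)) ^ 2 - 2 * (1 / 2 * (p / q + q / p)) * (s ^ 2 / (p * q)) + 1
      = (p ^ 2 - s ^ 2) * (q ^ 2 - s ^ 2) / (p * q) ^ 2 := by
    field_simp; ring
  have h2 : (s ^ 2 / (p * q)) ^ ((k : ℝ) - 1 / 2)
      = s ^ (2 * k) / (p * q) ^ k * (√(p * q) / s) := by
    rw [Real.rpow_sub (by positivity), Real.rpow_natCast, ← Real.sqrt_eq_rpow,
      Real.sqrt_div (by positivity), Real.sqrt_sq hs0.le, div_pow, ← pow_mul]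
    field_simp
  simp only [smul_eq_mul, h1, h2]
  rw [Real.sqrt_div (by positivity), Real.sqrt_sq hpq.le, Real.sqrt_mul hsp.le,
    abs_of_pos (by positivity)]
  have := Real.sqrt_pos.mpr hsp
  have := Real.sqrt_pos.mpr hsq
  field_simp

section ArcsineKernel

variable {s u : ℝ}

theorem arcsine_subst (hs : 0 ≤ s) (hsu : s < u) (f : ℝ → ℝ)
    (hf : ∀ q ∈ Set.Ioo s u, f q = q / (√(q ^ 2 - s ^ 2) * √(u ^ 2 - q ^ 2))) :
    IntegrableOn f (Set.Ioo s u) ∧ ∫ q in Set.Ioo s u, f q = π / 2 := by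
  have hd : 0 < u ^ 2 - s ^ 2 := by nlinarith
  have hpos : ∀ w ∈ Set.Ioo (0:ℝ) 1, 0 < s ^ 2 + (u ^ 2 - s ^ 2) * w := fun w hw => by
    have := hw.1; positivity
  have hG : ∀ w ∈ Set.Ioo (0:ℝ) 1, HasDerivAt (fun w => √(s ^ 2 + (u ^ 2 - s ^ 2) * w))
      ((u ^ 2 - s ^ 2) / (2 * √(s ^ 2 + (u ^ 2 - s ^ 2) * w))) w := fun w hw =>
    ((((hasDerivAt_id w).const_mul (u ^ 2 - s ^ 2)).const_add (s ^ 2)).sqrt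
      (hpos w hw).ne').congr_deriv (by simp)
  have hGS : ∀ w ∈ Set.Ioo (0:ℝ) 1, √(s ^ 2 + (u ^ 2 - s ^ 2) * w) ∈ Set.Ioo s u :=
    fun w hw => by
      have := mul_pos hd hw.1
      have := mul_pos hd (sub_pos.mpr hw.2)
      constructor
      · rw [Real.lt_sqrt hs]; linarith
      · rw [Real.sqrt_lt' (hs.trans_lt hsu)]; linarith
  have hW : ∀ q ∈ Set.Ioo s u, (q ^ 2 - s ^ 2) / (u ^ 2 - s ^ 2) ∈ Set.Ioo (0:ℝ) 1 :=
    fun q hq => by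
      have h1 : 0 < q ^ 2 - s ^ 2 := by nlinarith [hq.1]
      refine ⟨by positivity, ?_⟩
      rw [div_lt_one hd]
      nlinarith [hq.1, hq.2]
  have hGW : ∀ q ∈ Set.Ioo s u,
      √(s ^ 2 + (u ^ 2 - s ^ 2) * ((q ^ 2 - s ^ 2) / (u ^ 2 - s ^ 2))) = q := fun q hq => by
    rw [mul_div_cancel₀ _ hd.ne', add_sub_cancel, Real.sqrt_sq (hs.trans hq.1.le)]
  have hWG : ∀ w ∈ Set.Ioo (0:ℝ) 1,
      (√(s ^ 2 + (u ^ 2 - s ^ 2) * w) ^ 2 - s ^ 2) / (u ^ 2 - s ^ 2) = w := fun w hw => by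
    rw [Real.sq_sqrt (hpos w hw).le]; field_simp; ring
  have hone : ∀ α ∈ Set.Ioo 0 (π / 2),
      |(u ^ 2 - s ^ 2) / (2 * √(s ^ 2 + (u ^ 2 - s ^ 2) * cos α ^ 2))| * (2 * sin α * cos α) *
        f √(s ^ 2 + (u ^ 2 - s ^ 2) * cos α ^ 2) = 1 := fun α hα => by
    have hw := cos_sq_mem_Ioo hα
    have hS := sin_pos_of_mem hα
    have hC := cos_pos_of_mem hα
    have hp := hpos _ hw
    have h1 : s ^ 2 + (u ^ 2 - s ^ 2) * cos α ^ 2 - s ^ 2 = (u ^ 2 - s ^ 2) * cos α ^ 2 := by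
      ring
    have h2 : u ^ 2 - (s ^ 2 + (u ^ 2 - s ^ 2) * cos α ^ 2) = (u ^ 2 - s ^ 2) * sin α ^ 2 := by
      rw [sin_sq]; ring
    rw [hf _ (hGS _ hw), Real.sq_sqrt hp.le, h1, h2, Real.sqrt_mul hd.le, Real.sqrt_mul hd.le,
      Real.sqrt_sq hC.le, Real.sqrt_sq hS.le, abs_of_pos (by positivity)]
    have h3 := Real.sqrt_pos.mpr hp
    have h4 := Real.sqrt_pos.mpr hd
    have h5 := Real.sq_sqrt hd.le
    field_simp
    exact h5.symm
  constructor
  · rw [integrableOn_comp_cos_sq hG hGS hW hGW hWG, integrableOn_congr_fun hone measurableSet_Ioo]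
    exact integrableOn_const (by simp)
  · rw [integral_comp_cos_sq hG hGS hW hGW hWG, intervalIntegral.integral_of_le (by positivity),
      integral_Ioc_eq_integral_Ioo, setIntegral_congr_fun measurableSet_Ioo hone]
    simp [pi_div_two_pos.le]

theorem arcsine_inv_subst (hs : 0 < s) (hsu : s < u) (f : ℝ → ℝ)
    (hf : ∀ q ∈ Set.Ioo s u, f q = 1 / q / (√(q ^ 2 - s ^ 2) * √(u ^ 2 - q ^ 2))) :
    IntegrableOn f (Set.Ioo s u) ∧ ∫ q in Set.Ioo s u, f q = π / 2 / (s * u) := by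
  have hu : 0 < u := hs.trans hsu
  have hd : 0 < u ^ 2 - s ^ 2 := by nlinarith
  have hpos : ∀ w ∈ Set.Ioo (0:ℝ) 1, 0 < u ^ 2 - (u ^ 2 - s ^ 2) * w := fun w hw => by
    have := mul_pos hd (sub_pos.mpr hw.2)
    nlinarith
  have hG : ∀ w ∈ Set.Ioo (0:ℝ) 1, HasDerivAt (fun w => s * u / √(u ^ 2 - (u ^ 2 - s ^ 2) * w))
      (s * u * (u ^ 2 - s ^ 2) / (2 * ((u ^ 2 - (u ^ 2 - s ^ 2) * w)
        * √(u ^ 2 - (u ^ 2 - s ^ 2) * w)))) w := fun w hw => by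
    have h1 := Real.sqrt_pos.mpr (hpos w hw)
    refine ((hasDerivAt_const w (s * u)).div
      ((((hasDerivAt_id w).const_mul (u ^ 2 - s ^ 2)).const_sub (u ^ 2)).sqrt
      (hpos w hw).ne') h1.ne').congr_deriv ?_
    simp only [id, Real.sq_sqrt (hpos w hw).le]
    field_simp
    ring
  have hGS : ∀ w ∈ Set.Ioo (0:ℝ) 1, s * u / √(u ^ 2 - (u ^ 2 - s ^ 2) * w) ∈ Set.Ioo s u :=
    fun w hw => by
      have h1 := Real.sqrt_pos.mpr (hpos w hw)
      have := mul_pos hd hw.1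
      have := mul_pos hd (sub_pos.mpr hw.2)
      constructor
      · rw [lt_div_iff₀ h1, mul_lt_mul_iff_right₀ hs, Real.sqrt_lt' hu]; linarith
      · rw [div_lt_iff₀ h1, mul_comm s u, mul_lt_mul_iff_right₀ hu, Real.lt_sqrt hs.le]; linarith
  have hW : ∀ q ∈ Set.Ioo s u,
      (u ^ 2 - (s * u / q) ^ 2) / (u ^ 2 - s ^ 2) ∈ Set.Ioo (0:ℝ) 1 := fun q hq => by
    have h0 : 0 < q := hs.trans hq.1
    have h1 : s * u / q < u := by rw [div_lt_iff₀ h0]; nlinarith [hq.1]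
    have h2 : s < s * u / q := by rw [lt_div_iff₀ h0]; nlinarith [hq.2]
    have h3 : 0 < u ^ 2 - (s * u / q) ^ 2 := by nlinarith
    refine ⟨by positivity, ?_⟩
    rw [div_lt_one hd]
    nlinarith
  have hGW : ∀ q ∈ Set.Ioo s u, s * u / √(u ^ 2 - (u ^ 2 - s ^ 2) *
      ((u ^ 2 - (s * u / q) ^ 2) / (u ^ 2 - s ^ 2))) = q := fun q hq => by
    have h0 : 0 < q := hs.trans hq.1
    rw [mul_div_cancel₀ _ hd.ne', sub_sub_cancel, Real.sqrt_sq (by positivity)]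
    field_simp
  have hWG : ∀ w ∈ Set.Ioo (0:ℝ) 1, (u ^ 2 - (s * u /
      (s * u / √(u ^ 2 - (u ^ 2 - s ^ 2) * w))) ^ 2) / (u ^ 2 - s ^ 2) = w := fun w hw => by
    have h1 := Real.sqrt_pos.mpr (hpos w hw)
    rw [div_div_cancel₀ (by positivity), Real.sq_sqrt (hpos w hw).le]
    field_simp
    ring
  have hone : ∀ α ∈ Set.Ioo 0 (π / 2),
      |s * u * (u ^ 2 - s ^ 2) / (2 * ((u ^ 2 - (u ^ 2 - s ^ 2) * cos α ^ 2)
        * √(u ^ 2 - (u ^ 2 - s ^ 2) * cos α ^ 2)))| * (2 * sin α * cos α) *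
        f (s * u / √(u ^ 2 - (u ^ 2 - s ^ 2) * cos α ^ 2)) = 1 / (s * u) := fun α hα => by
    have hw := cos_sq_mem_Ioo hα
    have hS := sin_pos_of_mem hα
    have hC := cos_pos_of_mem hα
    have hp := hpos _ hw
    have h3 := Real.sqrt_pos.mpr hp
    have h4 := Real.sqrt_pos.mpr hd
    have h5 := Real.sq_sqrt hd.le
    rw [hf _ (hGS _ hw), div_pow, Real.sq_sqrt hp.le]
    have h1 : (s * u) ^ 2 / (u ^ 2 - (u ^ 2 - s ^ 2) * cos α ^ 2) - s ^ 2
        = s ^ 2 * cos α ^ 2 * (u ^ 2 - s ^ 2) / (u ^ 2 - (u ^ 2 - s ^ 2) * cos α ^ 2) := by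
      rw [eq_div_iff hp.ne', sub_mul, div_mul_cancel₀ _ hp.ne']; ring
    have h2 : u ^ 2 - (s * u) ^ 2 / (u ^ 2 - (u ^ 2 - s ^ 2) * cos α ^ 2)
        = u ^ 2 * sin α ^ 2 * (u ^ 2 - s ^ 2) / (u ^ 2 - (u ^ 2 - s ^ 2) * cos α ^ 2) := by
      rw [eq_div_iff hp.ne', sub_mul, div_mul_cancel₀ _ hp.ne', sin_sq]; ring
    rw [h1, h2, abs_of_pos (by positivity), Real.sqrt_div (by positivity),
      Real.sqrt_div (by positivity), ← mul_pow, ← mul_pow, Real.sqrt_mul (by positivity),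
      Real.sqrt_mul (by positivity), Real.sqrt_sq (by positivity), Real.sqrt_sq (by positivity)]
    have h6 := Real.sq_sqrt hp.le
    generalize u ^ 2 - (u ^ 2 - s ^ 2) * cos α ^ 2 = R at *
    generalize u ^ 2 - s ^ 2 = d at *
    field_simp
    rw [h5, h6]
    ring
  constructor
  · rw [integrableOn_comp_cos_sq hG hGS hW hGW hWG, integrableOn_congr_fun hone measurableSet_Ioo]
    exact integrableOn_const (by simp)
  · rw [integral_comp_cos_sq hG hGS hW hGW hWG, intervalIntegral.integral_of_le (by positivity),
      integral_Ioc_eq_integral_Ioo, setIntegral_congr_fun measurableSet_Ioo hone]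
    simp [pi_div_two_pos.le]
    field_simp

theorem integral_arcsine_kernel {k : ℕ} (hk : k = 0 ∨ k = 1) (hs : 0 < s) (hsu : s < u) :
    IntegrableOn (fun q => q / q ^ (2 * k) / (√(q ^ 2 - s ^ 2) * √(u ^ 2 - q ^ 2))) (Set.Ioo s u) ∧
      ∫ q in Set.Ioo s u, q / q ^ (2 * k) / (√(q ^ 2 - s ^ 2) * √(u ^ 2 - q ^ 2))
        = π / 2 / (s * u) ^ k := by
  rcases hk with rfl | rfl
  · simpa using arcsine_subst hs.le hsu _ fun q _ => rfl
  · simpa only [pow_one] using arcsine_inv_subst hs hsu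
      (fun q => q / q ^ (2 * 1) / (√(q ^ 2 - s ^ 2) * √(u ^ 2 - q ^ 2))) fun q hq => by
        have := hs.trans hq.1
        field_simp

theorem integrableOn_one_div_sqrt_sq_sub_sq (hu : 0 < u) :
    IntegrableOn (fun q => 1 / √(u ^ 2 - q ^ 2)) (Set.Ioo 0 u) :=
  (arcsine_subst le_rfl hu _ fun q hq => by
    have := hq.1
    rw [zero_pow two_ne_zero, sub_zero, Real.sqrt_sq hq.1.le]
    field_simp).1

end ArcsineKernel

/-- The kernel `q^(1-2k) / √((q²-s²)(u²-q²))`, cut off to `0 < s < q < u`. -/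
noncomputable def arcsineKernel (k : ℕ) (q s u : ℝ) : ℝ :=
  if 0 < s ∧ s < q ∧ q < u then q / q ^ (2 * k) / (√(q ^ 2 - s ^ 2) * √(u ^ 2 - q ^ 2)) else 0

theorem arcsineKernel_nonneg (k : ℕ) (q s u : ℝ) : 0 ≤ arcsineKernel k q s u := by
  unfold arcsineKernel
  split_ifs with h
  · have : 0 < q := h.1.trans h.2.1
    positivity
  · exact le_rfl

theorem measurable_arcsineKernel (k : ℕ) :
    Measurable fun x : ℝ × ℝ × ℝ => arcsineKernel k x.1 x.2.1 x.2.2 := by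
  unfold arcsineKernel
  have hs : Measurable fun x : ℝ × ℝ × ℝ => x.2.1 := by fun_prop
  have hu : Measurable fun x : ℝ × ℝ × ℝ => x.2.2 := by fun_prop
  exact Measurable.ite ((measurableSet_lt measurable_const hs).inter
    ((measurableSet_lt hs measurable_fst).inter (measurableSet_lt measurable_fst hu)))
    (by fun_prop) measurable_const

theorem arcsineKernel_eq_indicator (k : ℕ) {s u : ℝ} (hs : 0 < s) :
    (fun q => arcsineKernel k q s u) = (Set.Ioo s u).indicator
      fun q => q / q ^ (2 * k) / (√(q ^ 2 - s ^ 2) * √(u ^ 2 - q ^ 2)) := by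
  ext q
  simp [arcsineKernel, Set.indicator, hs]

theorem arcsineKernel_eq_zero (k : ℕ) {s u : ℝ} (h : ¬(0 < s ∧ s < u)) (q : ℝ) :
    arcsineKernel k q s u = 0 :=
  if_neg fun hq => h ⟨hq.1, hq.2.1.trans hq.2.2⟩

theorem integrable_arcsineKernel {k : ℕ} (hk : k = 0 ∨ k = 1) (s u : ℝ) :
    Integrable fun q => arcsineKernel k q s u := by
  by_cases h : 0 < s ∧ s < u
  · rw [arcsineKernel_eq_indicator k h.1]
    exact (integrable_indicator_iff measurableSet_Ioo).mpr (integral_arcsine_kernel hk h.1 h.2).1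
  · simp only [arcsineKernel_eq_zero k h]
    exact integrable_zero _ _ _

theorem integral_arcsineKernel_mul {k : ℕ} (hk : k = 0 ∨ k = 1) (s u : ℝ) :
    (∫ q, arcsineKernel k q s u) * (s * u) ^ k = if 0 < s ∧ s < u then π / 2 else 0 := by
  split_ifs with h
  · rw [arcsineKernel_eq_indicator k h.1, integral_indicator measurableSet_Ioo,
      (integral_arcsine_kernel hk h.1 h.2).2]
    have := h.1.trans h.2
    have := h.1
    field_simp
  · simp [arcsineKernel_eq_zero k h]

theorem integrable_arcsineKernel_mul {k : ℕ} (hk : k = 0 ∨ k = 1) {a b : ℝ → ℝ}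
    (ha : Integrable a) (hb : Integrable b) :
    Integrable (fun x : ℝ × ℝ × ℝ =>
      arcsineKernel k x.1 x.2.1 x.2.2 * ((x.2.1 * x.2.2) ^ k * (a x.2.1 * b x.2.2)))
      (volume.prod (volume.prod volume)) := by
  have hab := ha.mul_prod hb
  have hmeas : AEStronglyMeasurable (fun x : ℝ × ℝ × ℝ =>
      arcsineKernel k x.1 x.2.1 x.2.2 * ((x.2.1 * x.2.2) ^ k * (a x.2.1 * b x.2.2)))
      (volume.prod (volume.prod volume)) := by
    refine (measurable_arcsineKernel k).aestronglyMeasurable.mul (AEStronglyMeasurable.mul ?_ ?_)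
    · exact Measurable.aestronglyMeasurable (by fun_prop)
    · exact hab.1.comp_snd
  rw [integrable_prod_iff' hmeas]
  refine ⟨.of_forall fun y => (integrable_arcsineKernel hk y.1 y.2).mul_const
    ((y.1 * y.2) ^ k * (a y.1 * b y.2)), ?_⟩
  have hT : MeasurableSet {y : ℝ × ℝ | 0 < y.1 ∧ y.1 < y.2} :=
    (measurableSet_lt measurable_const measurable_fst).inter
      (measurableSet_lt measurable_fst measurable_snd)
  refine ((hab.norm.const_mul (π / 2)).indicator hT).congr (.of_forall fun y => ?_)
  simp only [norm_mul, Real.norm_of_nonneg (arcsineKernel_nonneg k _ _ _)]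
  rw [integral_mul_const]
  have h := integral_arcsineKernel_mul hk y.1 y.2
  by_cases hy : 0 < y.1 ∧ y.1 < y.2
  · rw [if_pos hy] at h
    rw [Set.indicator_of_mem (by exact hy), ← h, Real.norm_of_nonneg
      (pow_nonneg (mul_nonneg hy.1.le (hy.1.trans hy.2).le) k)]
    ring
  · rw [Set.indicator_of_notMem (by exact hy)]
    simp [arcsineKernel_eq_zero k hy]

theorem integral_prod_arcsineKernel_mul (k : ℕ) (a b : ℝ → ℝ) (q : ℝ) :
    ∫ y : ℝ × ℝ, arcsineKernel k q y.1 y.2 * ((y.1 * y.2) ^ k * (a y.1 * b y.2))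
      = (Set.Ioi 0).indicator (fun q => q / q ^ (2 * k) *
        ((∫ u in Set.Ioi q, u ^ k * b u / √(u ^ 2 - q ^ 2)) *
          ∫ s in Set.Ioo 0 q, s ^ k * a s / √(q ^ 2 - s ^ 2))) q := by
  by_cases hq : 0 < q
  · rw [Set.indicator_of_mem (by exact hq), ← integral_indicator measurableSet_Ioi,
      ← integral_indicator measurableSet_Ioo, mul_comm (integral _ _), ← integral_prod_mul,
      ← integral_const_mul]
    refine integral_congr_ae (.of_forall fun y => ?_)
    by_cases h1 : 0 < y.1 ∧ y.1 < q
    · by_cases h2 : q < y.2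
      · simp only [arcsineKernel, h1, h2, and_self, if_true, Set.indicator, Set.mem_Ioo,
          Set.mem_Ioi, mul_pow]
        ring
      · simp [arcsineKernel, h2, Set.indicator]
    · have : ¬(0 < y.1 ∧ y.1 < q ∧ q < y.2) := fun h => h1 ⟨h.1, h.2.1⟩
      simp only [arcsineKernel, if_neg this, Set.indicator, Set.mem_Ioo, if_neg h1]
      ring
  · rw [Set.indicator_of_notMem (by exact hq)]
    have : ∀ y : ℝ × ℝ, ¬(0 < y.1 ∧ y.1 < q ∧ q < y.2) := fun y h => hq (h.1.trans h.2.1)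
    simp [arcsineKernel, this]

/-- Two Abel transforms compose to integration against the Heaviside kernel. -/
theorem integral_abel_mul_abel {k : ℕ} (hk : k = 0 ∨ k = 1) {a b : ℝ → ℝ}
    (ha : Integrable a) (hb : Integrable b) :
    ∫ q in Set.Ioi 0, q / q ^ (2 * k) *
        ((∫ u in Set.Ioi q, u ^ k * b u / √(u ^ 2 - q ^ 2)) *
          ∫ s in Set.Ioo 0 q, s ^ k * a s / √(q ^ 2 - s ^ 2))
      = π / 2 * ∫ s in Set.Ioi 0, a s * ∫ u in Set.Ioi s, b u := by
  have hF := integrable_arcsineKernel_mul hk ha hb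
  have hab := ha.mul_prod hb
  have hT : MeasurableSet {y : ℝ × ℝ | 0 < y.1 ∧ y.1 < y.2} :=
    (measurableSet_lt measurable_const measurable_fst).inter
      (measurableSet_lt measurable_fst measurable_snd)
  rw [← integral_indicator measurableSet_Ioi]
  simp only [← integral_prod_arcsineKernel_mul]
  refine (integral_integral_swap hF).trans ?_
  have h1 : ∀ y : ℝ × ℝ,
      ∫ q, arcsineKernel k q y.1 y.2 * ((y.1 * y.2) ^ k * (a y.1 * b y.2))
        = π / 2 * {y : ℝ × ℝ | 0 < y.1 ∧ y.1 < y.2}.indicator (fun y => a y.1 * b y.2) y := by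
    intro y
    rw [integral_mul_const, ← mul_assoc, integral_arcsineKernel_mul hk]
    by_cases hy : 0 < y.1 ∧ y.1 < y.2 <;> simp [Set.indicator, hy]
  simp only [h1]
  rw [integral_const_mul]
  congr 1
  refine (integral_prod _ (hab.indicator hT)).trans ?_
  rw [← integral_indicator measurableSet_Ioi]
  refine integral_congr_ae (.of_forall fun s => ?_)
  by_cases hs : 0 < s
  · rw [Set.indicator_of_mem (by exact hs), ← integral_const_mul,
      ← integral_indicator measurableSet_Ioi]
    refine integral_congr_ae (.of_forall fun u => ?_)
    simp [Set.indicator, hs]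
  · rw [Set.indicator_of_notMem (by exact hs)]
    simp [Set.indicator, hs]

theorem integrable_indicator_pow_div_sqrt (k : ℕ) {p : ℝ} (hp : 0 < p) :
    Integrable ((Set.Ioo 0 p).indicator fun s => s ^ k / √(p ^ 2 - s ^ 2)) := by
  rw [integrable_indicator_iff measurableSet_Ioo]
  refine ((integrableOn_one_div_sqrt_sq_sub_sq hp).const_mul (p ^ k)).mono'
    (Measurable.aestronglyMeasurable (by fun_prop))
    ((ae_restrict_iff' measurableSet_Ioo).mpr (.of_forall fun s hs => ?_))
  have h0 := hs.1
  rw [Real.norm_of_nonneg (by positivity), mul_one_div]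
  gcongr
  exact hs.2.le

theorem trial_function_integral (k : ℕ) (hk : k = 0 ∨ k = 1) (p : ℝ) (hp : 0 < p) :
    (∫ p' in Set.Ioi (0:ℝ),
        hTrial k p' * legendreQ ((k : ℝ) - 1/2) ((1/2) * (p / p' + p' / p))) =
      Real.pi * Real.sqrt p * (p ^ 2 + 1) ^ (-(1:ℝ)/4) * Real.Gamma ((k : ℝ) + 1/2) *
        (1 / (k.factorial : ℝ)) *
        ((1 + (p ^ 2 + 1) ^ (-(1:ℝ)/2)) / (1 - (p ^ 2 + 1) ^ (-(1:ℝ)/2))) ^ (-(k : ℝ)/2) *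
        Fhyp (1/2) (1/2) (1 + (k : ℝ)) ((1 - (p ^ 2 + 1) ^ (-(1:ℝ)/2)) / 2) := by
  have hε : ((-1 : ℝ) ^ k) ^ 2 = 1 := by rw [← pow_mul, mul_comm, pow_mul]; simp
  rw [Fhyp_half_half_eq_abel_integral hk hp]
  have hA := integral_abel_mul_abel hk (integrable_indicator_pow_div_sqrt k hp)
    (integrable_halfAngleRate hε)
  have hR : ∫ s in Set.Ioi 0, (Set.Ioo 0 p).indicator (fun s => s ^ k / √(p ^ 2 - s ^ 2)) s *
        ∫ u in Set.Ioi s, halfAngleRate ((-1) ^ k) u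
      = ∫ s in Set.Ioo 0 p, s ^ k * halfAngle ((-1) ^ k) s / √(p ^ 2 - s ^ 2) := by
    rw [← integral_indicator measurableSet_Ioi, ← integral_indicator measurableSet_Ioo]
    refine integral_congr_ae (.of_forall fun s => ?_)
    by_cases hs : s ∈ Set.Ioo 0 p
    · simp only [Set.indicator_of_mem hs, Set.indicator_of_mem (show s ∈ Set.Ioi 0 from hs.1),
        integral_Ioi_halfAngleRate hε hs.1]
      ring
    · simp only [Set.indicator, if_neg hs, zero_mul, ite_self]
  rw [hR] at hA
  have hL : ∫ q in Set.Ioi 0, hTrial k q * legendreQ ((k : ℝ) - 1 / 2) (1 / 2 * (p / q + q / p))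
      = 2 * √p / √π / p ^ k * (π / 2 *
        ∫ s in Set.Ioo 0 p, s ^ k * halfAngle ((-1) ^ k) s / √(p ^ 2 - s ^ 2)) := by
    rw [← hA, ← integral_const_mul]
    refine setIntegral_congr_fun measurableSet_Ioi fun q hq => ?_
    have hq0 : 0 < q := hq
    have hJ : ∫ s in Set.Ioo 0 (min p q), s ^ (2 * k) / (√(p ^ 2 - s ^ 2) * √(q ^ 2 - s ^ 2))
        = ∫ s in Set.Ioo 0 q, s ^ k * (Set.Ioo 0 p).indicator
          (fun s => s ^ k / √(p ^ 2 - s ^ 2)) s / √(q ^ 2 - s ^ 2) := by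
      rw [← integral_indicator measurableSet_Ioo, ← integral_indicator measurableSet_Ioo]
      refine integral_congr_ae (.of_forall fun s => ?_)
      by_cases h0 : 0 < s <;> by_cases h1 : s < p <;> by_cases h2 : s < q <;>
        simp [Set.indicator, h0, h1, h2]
      ring
    simp only [hTrial_eq_integral hk hq0, legendreQ_eq_integral k hp hq0, hJ]
    rw [Real.sqrt_mul hp.le]
    have := Real.sq_sqrt hq0.le
    generalize ∫ s in Set.Ioo 0 q, s ^ k * (Set.Ioo 0 p).indicator
          (fun s => s ^ k / √(p ^ 2 - s ^ 2)) s / √(q ^ 2 - s ^ 2) = J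
    generalize ∫ u in Set.Ioi q, u ^ k * halfAngleRate ((-1) ^ k) u / √(u ^ 2 - q ^ 2) = I
    have hpi := Real.sqrt_pos.mpr pi_pos
    rw [mul_pow, two_mul k, pow_add]
    field_simp
    rw [this]
    ring
  rw [hL]
  have hpi := Real.sqrt_pos.mpr pi_pos
  have hpi2 := Real.sq_sqrt pi_pos.le
  generalize ∫ s in Set.Ioo 0 p, s ^ k * halfAngle ((-1) ^ k) s / √(p ^ 2 - s ^ 2) = J
  field_simp
  rw [hpi2]
end

section
/- The function x ↦ Γ(x)/Γ(x + 1/2) is strictly decreasing on (0,∞); that is, for all 0 < x < y one has Γ(y)/Γ(y + 1/2) < Γ(x)/Γ(x + 1/2). -/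
open Real

/-- Log-convexity of `Γ`, in multiplicative form: shifting both arguments outwards increases
the product. -/
lemma Gamma_add_mul_Gamma_le {x y h : ℝ} (hx : 0 < x) (hxy : x < y) (hh : 0 < h) :
    Real.Gamma (x + h) * Real.Gamma y ≤ Real.Gamma x * Real.Gamma (y + h) := by
  have hy : 0 < y := hx.trans hxy
  have hd : 0 < y - x + h := by linarith
  have hconv := Real.convexOn_log_Gamma.2
  have hx_mem : x ∈ Set.Ioi (0 : ℝ) := hx
  have hyh_mem : y + h ∈ Set.Ioi (0 : ℝ) := Set.mem_Ioi.2 (by linarith)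
  have hs : 0 ≤ (y - x) / (y - x + h) := div_nonneg (by linarith) hd.le
  have ht : 0 ≤ h / (y - x + h) := by positivity
  have hst : (y - x) / (y - x + h) + h / (y - x + h) = 1 := by field_simp
  have h₁ := hconv hx_mem hyh_mem hs ht hst
  have h₂ := hconv hx_mem hyh_mem ht hs (by rw [add_comm, hst])
  have e₁ : (y - x) / (y - x + h) * x + h / (y - x + h) * (y + h) = x + h := by
    field_simp; ring
  have e₂ : h / (y - x + h) * x + (y - x) / (y - x + h) * (y + h) = y := by
    field_simp; ring
  simp only [smul_eq_mul, Function.comp_apply, e₁, e₂] at h₁ h₂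
  have p₁ := Real.Gamma_pos_of_pos hx
  have p₂ := Real.Gamma_pos_of_pos hy
  have p₃ := Real.Gamma_pos_of_pos (add_pos hx hh)
  have p₄ := Real.Gamma_pos_of_pos (add_pos hy hh)
  rw [← Real.log_le_log_iff (by positivity) (by positivity),
    Real.log_mul p₃.ne' p₂.ne', Real.log_mul p₁.ne' p₄.ne']
  linear_combination h₁ + h₂ + (Real.log (Real.Gamma x) + Real.log (Real.Gamma (y + h))) * hst

/-- The function `x ↦ Γ(x)/Γ(x+1/2)` is strictly decreasing on `(0,∞)`. -/
theorem Gamma_ratio_strictAnti (x y : ℝ) (hx : 0 < x) (hxy : x < y) :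
    Real.Gamma y / Real.Gamma (y + 1/2) < Real.Gamma x / Real.Gamma (x + 1/2) := by
  have hy : 0 < y := hx.trans hxy
  have hx' : 0 < x + 1/2 := by linarith
  have hy' : 0 < y + 1/2 := by linarith
  have p₁ := Real.Gamma_pos_of_pos hx
  have p₂ := Real.Gamma_pos_of_pos hy
  have p₃ := Real.Gamma_pos_of_pos hx'
  have p₄ := Real.Gamma_pos_of_pos hy'
  have key := Gamma_add_mul_Gamma_le (x := x + 1) (y := y + 1) (h := 1/2)
    (by linarith) (by linarith) (by norm_num)
  rw [add_right_comm x, add_right_comm y, Real.Gamma_add_one hx.ne', Real.Gamma_add_one hy.ne',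
    Real.Gamma_add_one hx'.ne', Real.Gamma_add_one hy'.ne'] at key
  rw [div_lt_div_iff₀ p₄ p₃]
  have hlt : x * (y + 1/2) < (x + 1/2) * y := by linarith
  by_contra! hcon
  have hle : (x * (y + 1/2)) * (Real.Gamma x * Real.Gamma (y + 1/2)) ≤
      (x * (y + 1/2)) * (Real.Gamma y * Real.Gamma (x + 1/2)) := by gcongr
  have hstrict := mul_lt_mul_of_pos_right hlt (mul_pos p₂ p₃)
  linarith
end

section
/- For every x with 0 ≤ x ≤ 0.4, one has ∑_{k=0}^∞ [ Γ(1/4 + k)²/(Γ(1/2 + k)·k!)·x^{2k} − Γ(3/4 + k)²/(Γ(3/2 + k)·k!)·x^{2k+1} ] ≤ Γ(1/4)²/√π − (4π^{3/2}/Γ(1/4)²)·x + (Γ(1/4)²/(8√π))·x². -/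
open Real

/-- Logarithmic convexity of `Γ` at the midpoint of `s` and `s + 1`. -/
lemma Gamma_add_half_sq_le {s : ℝ} (hs : 0 < s) :
    Real.Gamma (s + 1/2) ^ 2 ≤ s * Real.Gamma s ^ 2 := by
  have h := Real.Gamma_mul_add_mul_le_rpow_Gamma_mul_rpow_Gamma hs (by linarith : 0 < s + 1)
    (by norm_num : (0:ℝ) < 1/2) (by norm_num : (0:ℝ) < 1/2) (by norm_num)
  rw [show 1/2 * s + 1/2 * (s + 1) = s + 1/2 by ring, ← Real.sqrt_eq_rpow, ← Real.sqrt_eq_rpow,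
    Real.Gamma_add_one hs.ne'] at h
  have hG := Real.Gamma_pos_of_pos hs
  have hG' := Real.Gamma_pos_of_pos (by linarith : 0 < s + 1/2)
  calc Real.Gamma (s + 1/2) ^ 2 ≤ (√(Real.Gamma s) * √(s * Real.Gamma s)) ^ 2 := by gcongr
    _ = s * Real.Gamma s ^ 2 := by
      rw [mul_pow, Real.sq_sqrt hG.le, Real.sq_sqrt (by positivity)]; ring

/-- The coefficient `Γ(s + k)² / (Γ(t + k) k!)` of a Gauss hypergeometric series. -/
noncomputable def gammaCoeff (s t : ℝ) (k : ℕ) : ℝ :=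
  Real.Gamma (s + k) ^ 2 / (Real.Gamma (t + k) * (k.factorial : ℝ))

lemma gammaCoeff_nonneg {s t : ℝ} (ht : 0 < t) (k : ℕ) : 0 ≤ gammaCoeff s t k := by
  have := Real.Gamma_pos_of_pos (by positivity : 0 < t + k)
  unfold gammaCoeff
  positivity

lemma gammaCoeff_succ {s t : ℝ} (hs : 0 < s) (ht : 0 < t) (k : ℕ) :
    gammaCoeff s t (k + 1) = gammaCoeff s t k * ((s + k) ^ 2 / ((t + k) * (k + 1))) := by
  have hs' : 0 < s + k := by positivity
  have ht' : 0 < t + k := by positivity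
  have hG := Real.Gamma_pos_of_pos ht'
  unfold gammaCoeff
  rw [Nat.factorial_succ]
  push_cast
  rw [← add_assoc, ← add_assoc, Real.Gamma_add_one hs'.ne', Real.Gamma_add_one ht'.ne']
  field_simp

lemma gammaCoeff_le_zero {s t : ℝ} (hs : 0 < s) (hs1 : s ≤ 1) (hst : s ≤ t) (k : ℕ) :
    gammaCoeff s t k ≤ gammaCoeff s t 0 := by
  have ht : 0 < t := hs.trans_le hst
  induction k with
  | zero => rfl
  | succ k ih =>
    rw [gammaCoeff_succ hs ht]
    refine (mul_le_of_le_one_right (gammaCoeff_nonneg ht k) ?_).trans ih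
    rw [div_le_one (by positivity), sq]
    gcongr ?_ * ?_ <;> linarith

lemma summable_gammaCoeff_mul_pow {s t x : ℝ} (hs : 0 < s) (hs1 : s ≤ 1) (hst : s ≤ t)
    (hx0 : 0 ≤ x) (hx1 : x < 1) : Summable fun k : ℕ => gammaCoeff s t k * x ^ (2 * k) := by
  have ht : 0 < t := hs.trans_le hst
  refine Summable.of_nonneg_of_le
    (fun k => mul_nonneg (gammaCoeff_nonneg ht k) (by positivity)) (fun k => ?_)
    ((summable_geometric_of_lt_one (sq_nonneg x) (by nlinarith)).mul_left (gammaCoeff s t 0))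
  rw [pow_mul]
  gcongr
  exact gammaCoeff_le_zero hs hs1 hst k

lemma gammaCoeff_quarter_succ_le (k : ℕ) :
    gammaCoeff (1/4) (1/2) (k + 1) ≤ gammaCoeff (3/4) (3/2) k := by
  have h := Gamma_add_half_sq_le (by positivity : (0:ℝ) < 3/4 + k)
  have hG := Real.Gamma_pos_of_pos (by positivity : (0:ℝ) < 3/2 + k)
  unfold gammaCoeff
  rw [Nat.factorial_succ]
  push_cast
  rw [show (1/4 + (k + 1) : ℝ) = 3/4 + k + 1/2 by ring,
    show (1/2 + (k + 1) : ℝ) = 3/2 + k by ring, div_le_div_iff₀ (by positivity) (by positivity)]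
  calc Real.Gamma (3/4 + k + 1/2) ^ 2 * (Real.Gamma (3/2 + k) * k.factorial)
      ≤ ((k + 1) * Real.Gamma (3/4 + k) ^ 2) * (Real.Gamma (3/2 + k) * k.factorial) := by
        gcongr
        refine h.trans ?_
        gcongr ?_ * _
        linarith
    _ = _ := by ring

lemma Gamma_three_quarters_mul : Real.Gamma (3/4) * Real.Gamma (1/4) = π * √2 := by
  have h := Real.Gamma_mul_Gamma_one_sub (1/4)
  rw [show (1 - 1/4 : ℝ) = 3/4 by norm_num, show π * (1/4) = π / 4 by ring,
    Real.sin_pi_div_four] at h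
  rw [mul_comm, h]
  field_simp
  norm_num

lemma gammaCoeff_quarter_zero :
    gammaCoeff (1/4) (1/2) 0 = Real.Gamma (1/4) ^ 2 / √π := by
  simp [gammaCoeff, ← Real.Gamma_one_half_eq]

lemma gammaCoeff_quarter_one :
    gammaCoeff (1/4) (1/2) 1 = Real.Gamma (1/4) ^ 2 / (8 * √π) := by
  have h := gammaCoeff_succ (by norm_num : (0:ℝ) < 1/4) (by norm_num : (0:ℝ) < 1/2) 0
  rw [zero_add, gammaCoeff_quarter_zero] at h
  rw [h]
  have := Real.sqrt_pos.2 Real.pi_pos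
  norm_num
  field_simp

lemma gammaCoeff_three_quarters_zero :
    gammaCoeff (3/4) (3/2) 0 = 4 * π ^ ((3:ℝ)/2) / Real.Gamma (1/4) ^ 2 := by
  have hG := Real.Gamma_pos_of_pos (by norm_num : (0:ℝ) < 1/4)
  have hπ := Real.sqrt_pos.2 Real.pi_pos
  have h32 : Real.Gamma (3/2) = √π / 2 := by
    rw [show (3/2 : ℝ) = 1/2 + 1 by norm_num, Real.Gamma_add_one (by norm_num),
      Real.Gamma_one_half_eq]
    ring
  have hpow : π ^ ((3:ℝ)/2) = π * √π := by
    rw [show (3:ℝ)/2 = 1 + 1/2 by norm_num, Real.rpow_add Real.pi_pos, Real.rpow_one,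
      Real.sqrt_eq_rpow]
  have h : Real.Gamma (3/4) ^ 2 * Real.Gamma (1/4) ^ 2 = π ^ 2 * 2 := by
    rw [← mul_pow, Gamma_three_quarters_mul, mul_pow, Real.sq_sqrt (by norm_num)]
  simp only [gammaCoeff, Nat.cast_zero, add_zero, Nat.factorial_zero, Nat.cast_one, mul_one]
  rw [h32, hpow, div_eq_div_iff (by positivity) (by positivity), h]
  linear_combination (-2 * π) * Real.sq_sqrt Real.pi_pos.le

lemma tsum_sub_le_of_shift_le {f g : ℕ → ℝ} (hf : Summable f) (hg : Summable g)
    (h : ∀ k, f (k + 2) ≤ g (k + 1)) : ∑' k, (f k - g k) ≤ f 0 + f 1 - g 0 := by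
  have hf2 := hf.sum_add_tsum_nat_add 2
  have hg1 := hg.sum_add_tsum_nat_add 1
  simp only [Finset.sum_range_succ, Finset.sum_range_zero, zero_add] at hf2 hg1
  have hle := Summable.tsum_le_tsum h ((summable_nat_add_iff 2).2 hf) ((summable_nat_add_iff 1).2 hg)
  rw [hf.tsum_sub hg]
  linarith

theorem P_neg_half_upper_bound (x : ℝ) (hx0 : 0 ≤ x) (hx : x ≤ 0.4) :
    (∑' k : ℕ,
        (Real.Gamma (1/4 + k) ^ 2 / (Real.Gamma (1/2 + k) * (k.factorial : ℝ)) * x ^ (2 * k) -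
          Real.Gamma (3/4 + k) ^ 2 / (Real.Gamma (3/2 + k) * (k.factorial : ℝ)) *
            x ^ (2 * k + 1))) ≤
      Real.Gamma (1/4) ^ 2 / Real.sqrt Real.pi -
        4 * Real.pi ^ ((3:ℝ)/2) / Real.Gamma (1/4) ^ 2 * x +
        Real.Gamma (1/4) ^ 2 / (8 * Real.sqrt Real.pi) * x ^ 2 := by
  have hx1 : x < 1 := by norm_num at hx; linarith
  rw [← gammaCoeff_quarter_zero, ← gammaCoeff_quarter_one, ← gammaCoeff_three_quarters_zero]
  change ∑' k : ℕ, (gammaCoeff (1/4) (1/2) k * x ^ (2 * k) -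
    gammaCoeff (3/4) (3/2) k * x ^ (2 * k + 1)) ≤ _
  have hA : Summable fun k : ℕ => gammaCoeff (1/4) (1/2) k * x ^ (2 * k) :=
    summable_gammaCoeff_mul_pow (by norm_num) (by norm_num) (by norm_num) hx0 hx1
  have hB : Summable fun k : ℕ => gammaCoeff (3/4) (3/2) k * x ^ (2 * k + 1) := by
    simp only [pow_succ x, ← mul_assoc]
    exact (summable_gammaCoeff_mul_pow (by norm_num) (by norm_num) (by norm_num) hx0 hx1).mul_right x
  have hle (k : ℕ) : gammaCoeff (1/4) (1/2) (k + 2) * x ^ (2 * (k + 2)) ≤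
      gammaCoeff (3/4) (3/2) (k + 1) * x ^ (2 * (k + 1) + 1) :=
    mul_le_mul (gammaCoeff_quarter_succ_le (k + 1))
      (pow_le_pow_of_le_one hx0 hx1.le (by omega)) (by positivity)
      (gammaCoeff_nonneg (by norm_num) _)
  refine (tsum_sub_le_of_shift_le hA hB hle).trans_eq ?_
  simp only [mul_zero, pow_zero, zero_add, mul_one, pow_one]
  ring
end

section
/- For every x with 0 ≤ x ≤ 0.4, one has ∑_{k=0}^∞ [ −Γ(3/4 + k)·Γ(−1/4 + k)/(Γ(1/2 + k)·k!)·x^{2k} + Γ(1/4 + k)·Γ(5/4 + k)/(Γ(3/2 + k)·k!)·x^{2k+1} ] ≥ 8π^{3/2}/Γ(1/4)² + (Γ(1/4)²/(2√π))·x − (3π^{3/2}/Γ(1/4)²)·x². -/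
open Real

/-- The coefficient of `x ^ (2 * k)` in the expansion of `2 π P_{1/2}(x)`. -/
noncomputable def evenCoeff (k : ℕ) : ℝ :=
  -(Real.Gamma (3/4 + k) * Real.Gamma (-(1/4) + k)) /
    (Real.Gamma (1/2 + k) * (k.factorial : ℝ))

/-- The coefficient of `x ^ (2 * k + 1)` in the expansion of `2 π P_{1/2}(x)`. -/
noncomputable def oddCoeff (k : ℕ) : ℝ :=
  Real.Gamma (1/4 + k) * Real.Gamma (5/4 + k) /
    (Real.Gamma (3/2 + k) * (k.factorial : ℝ))

lemma neg_quarter_add_natCast_ne_zero (k : ℕ) : (-(1/4) + k : ℝ) ≠ 0 := by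
  rcases k with _ | k
  · norm_num
  · have : (0 : ℝ) ≤ k := k.cast_nonneg
    push_cast
    linarith

lemma evenCoeff_succ (k : ℕ) :
    evenCoeff (k + 1) =
      evenCoeff k * ((3/4 + k) * (-(1/4) + k) / ((1/2 + k) * (k + 1))) := by
  have hk : (0 : ℝ) ≤ k := k.cast_nonneg
  have hG : Real.Gamma (1/2 + k) ≠ 0 := (Real.Gamma_pos_of_pos (by linarith)).ne'
  have hf : (k.factorial : ℝ) ≠ 0 := by positivity
  have h1 : (1/2 + k : ℝ) ≠ 0 := by positivity
  have h2 : (k + 1 : ℝ) ≠ 0 := by positivity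
  unfold evenCoeff
  push_cast [Nat.factorial_succ]
  rw [← add_assoc, ← add_assoc, ← add_assoc, Real.Gamma_add_one (by positivity),
    Real.Gamma_add_one (neg_quarter_add_natCast_ne_zero k), Real.Gamma_add_one h1]
  generalize Real.Gamma (1/2 + k) = G at *
  generalize (1/2 + k : ℝ) = u at *
  field_simp

lemma oddCoeff_succ (k : ℕ) :
    oddCoeff (k + 1) =
      oddCoeff k * ((1/4 + k) * (5/4 + k) / ((3/2 + k) * (k + 1))) := by
  have hk : (0 : ℝ) ≤ k := k.cast_nonneg
  have hG : Real.Gamma (3/2 + k) ≠ 0 := (Real.Gamma_pos_of_pos (by linarith)).ne'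
  have hf : (k.factorial : ℝ) ≠ 0 := by positivity
  have h1 : (3/2 + k : ℝ) ≠ 0 := by positivity
  have h2 : (k + 1 : ℝ) ≠ 0 := by positivity
  unfold oddCoeff
  push_cast [Nat.factorial_succ]
  rw [← add_assoc, ← add_assoc, ← add_assoc, Real.Gamma_add_one (by positivity),
    Real.Gamma_add_one (by positivity), Real.Gamma_add_one h1]
  generalize Real.Gamma (3/2 + k) = G at *
  generalize (3/2 + k : ℝ) = u at *
  field_simp

lemma oddCoeff_nonneg (k : ℕ) : 0 ≤ oddCoeff k := by
  have hk : (0 : ℝ) ≤ k := k.cast_nonneg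
  have h1 := Real.Gamma_pos_of_pos (show (0 : ℝ) < 1/4 + k by linarith)
  have h2 := Real.Gamma_pos_of_pos (show (0 : ℝ) < 5/4 + k by linarith)
  have h3 := Real.Gamma_pos_of_pos (show (0 : ℝ) < 3/2 + k by linarith)
  unfold oddCoeff
  positivity

lemma oddCoeff_antitone : Antitone oddCoeff := by
  refine antitone_nat_of_succ_le fun k => ?_
  have hk : (0 : ℝ) ≤ k := k.cast_nonneg
  rw [oddCoeff_succ]
  refine mul_le_of_le_one_right (oddCoeff_nonneg k) ?_
  rw [div_le_one (by positivity)]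
  nlinarith

lemma evenCoeff_succ_nonpos (k : ℕ) : evenCoeff (k + 1) ≤ 0 := by
  have hk : (0 : ℝ) ≤ k := k.cast_nonneg
  have h1 := Real.Gamma_pos_of_pos (show (0 : ℝ) < 3/4 + (k + 1 : ℕ) by push_cast; linarith)
  have h2 := Real.Gamma_pos_of_pos (show (0 : ℝ) < -(1/4) + (k + 1 : ℕ) by push_cast; linarith)
  have h3 := Real.Gamma_pos_of_pos (show (0 : ℝ) < 1/2 + (k + 1 : ℕ) by push_cast; linarith)
  unfold evenCoeff
  rw [neg_div, neg_nonpos]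
  positivity

lemma evenCoeff_succ_monotone : Monotone fun k => evenCoeff (k + 1) := by
  refine monotone_nat_of_le_succ fun k => ?_
  have hk : (0 : ℝ) ≤ k := k.cast_nonneg
  have h0 := evenCoeff_succ_nonpos k
  show evenCoeff (k + 1) ≤ evenCoeff (k + 1 + 1)
  rw [evenCoeff_succ (k + 1)]
  refine le_mul_of_le_one_right h0 ?_
  push_cast
  rw [div_le_one (by positivity)]
  nlinarith

lemma Gamma_quarter_mul_Gamma_three_quarters :
    Real.Gamma (1/4) * Real.Gamma (3/4) = π * √2 := by
  have h := Real.Gamma_mul_Gamma_one_sub (1/4)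
  rw [show (1 - 1/4 : ℝ) = 3/4 by norm_num, show π * (1/4) = π / 4 by ring,
    Real.sin_pi_div_four] at h
  rw [h]
  have h2 : √2 ^ 2 = (2 : ℝ) := Real.sq_sqrt (by norm_num)
  have h3 : √2 ≠ (0 : ℝ) := by positivity
  field_simp
  linarith

lemma pi_rpow_three_halves : π ^ ((3 : ℝ)/2) = π * √π := by
  rw [Real.sqrt_eq_rpow, show (3 : ℝ)/2 = 1 + 1/2 by norm_num, Real.rpow_add pi_pos,
    Real.rpow_one]

lemma evenCoeff_zero : evenCoeff 0 = 8 * π ^ ((3 : ℝ)/2) / Real.Gamma (1/4) ^ 2 := by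
  have hq : 0 < Real.Gamma (1/4) := Real.Gamma_pos_of_pos (by norm_num)
  have h := Real.Gamma_add_one (show (-(1/4) : ℝ) ≠ 0 by norm_num)
  rw [show (-(1/4) + 1 : ℝ) = 3/4 by norm_num] at h
  have h' : Real.Gamma (-(1/4)) = -4 * Real.Gamma (3/4) := by linarith
  have hp : Real.Gamma (3/4) = π * √2 / Real.Gamma (1/4) := by
    rw [eq_div_iff hq.ne', mul_comm, Gamma_quarter_mul_Gamma_three_quarters]
  have h2 : √2 ^ 2 = (2 : ℝ) := Real.sq_sqrt (by norm_num)
  have h3 : √π ^ 2 = π := Real.sq_sqrt pi_pos.le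
  have h4 : √π ≠ 0 := by positivity
  simp only [evenCoeff, Nat.cast_zero, add_zero, Nat.factorial_zero, Nat.cast_one, mul_one]
  rw [h', hp, Real.Gamma_one_half_eq, pi_rpow_three_halves]
  field_simp
  rw [h2, h3]
  ring

lemma oddCoeff_zero : oddCoeff 0 = Real.Gamma (1/4) ^ 2 / (2 * √π) := by
  have h := Real.Gamma_add_one (show (1/4 : ℝ) ≠ 0 by norm_num)
  rw [show (1/4 + 1 : ℝ) = 5/4 by norm_num] at h
  have h' := Real.Gamma_add_one (show (1/2 : ℝ) ≠ 0 by norm_num)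
  rw [show (1/2 + 1 : ℝ) = 3/2 by norm_num, Real.Gamma_one_half_eq] at h'
  have h4 : √π ≠ 0 := by positivity
  simp only [oddCoeff, Nat.cast_zero, add_zero, Nat.factorial_zero, Nat.cast_one, mul_one]
  rw [h, h']
  field_simp
  norm_num

lemma Gamma_three_quarters_le : Real.Gamma (3/4) ≤ 4/3 := by
  have h := Real.Gamma_add_one (show (3/4 : ℝ) ≠ 0 by norm_num)
  have hc := Real.convexOn_Gamma.2 (show (1 : ℝ) ∈ Set.Ioi 0 by norm_num)
    (show (2 : ℝ) ∈ Set.Ioi 0 by norm_num) (show (0 : ℝ) ≤ 1/4 by norm_num)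
    (show (0 : ℝ) ≤ 3/4 by norm_num) (by norm_num)
  simp only [smul_eq_mul, Real.Gamma_one, Real.Gamma_two] at hc
  rw [show (1/4 * 1 + 3/4 * 2 : ℝ) = 3/4 + 1 by norm_num, h] at hc
  linarith

lemma evenCoeff_zero_le : evenCoeff 0 ≤ 2 * oddCoeff 0 := by
  have hq : 0 < Real.Gamma (1/4) := Real.Gamma_pos_of_pos (by norm_num)
  have ht : 0 < Real.Gamma (3/4) := Real.Gamma_pos_of_pos (by norm_num)
  have h2 : √2 ^ 2 = (2 : ℝ) := Real.sq_sqrt (by norm_num)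
  have h3 : √π ^ 2 = π := Real.sq_sqrt pi_pos.le
  have h4 : 0 < √π := by positivity
  have e : Real.Gamma (1/4) ^ 2 * Real.Gamma (3/4) ^ 2 = π ^ 2 * 2 := by
    rw [← mul_pow, Gamma_quarter_mul_Gamma_three_quarters, mul_pow, h2]
  have ht2 : Real.Gamma (3/4) ^ 2 ≤ 16/9 := by nlinarith [Gamma_three_quarters_le]
  have hq2 : 9/8 * π ^ 2 ≤ Real.Gamma (1/4) ^ 2 := by
    nlinarith [mul_le_mul_of_nonneg_left ht2 (sq_nonneg (Real.Gamma (1/4)))]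
  have hpi : (9 : ℝ) ≤ π ^ 2 := by nlinarith [pi_gt_three]
  have hq4 : 8 * π ^ 2 ≤ Real.Gamma (1/4) ^ 2 * Real.Gamma (1/4) ^ 2 := by
    nlinarith [mul_le_mul hq2 hq2 (by positivity) (by positivity)]
  rw [evenCoeff_zero, oddCoeff_zero, pi_rpow_three_halves, mul_div_assoc', div_le_div_iff₀
    (by positivity) (by positivity)]
  calc 8 * (π * √π) * (2 * √π) = 2 * (8 * (π * √π ^ 2)) := by ring
    _ = 2 * (8 * π ^ 2) := by rw [h3]; ring
    _ ≤ 2 * (Real.Gamma (1/4) ^ 2 * Real.Gamma (1/4) ^ 2) := by gcongr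
    _ = 2 * Real.Gamma (1/4) ^ 2 * Real.Gamma (1/4) ^ 2 := by ring

lemma evenCoeff_one : evenCoeff 1 = -(3/8) * evenCoeff 0 := by
  have h := evenCoeff_succ 0
  norm_num at h
  linarith

lemma evenCoeff_two : evenCoeff 2 = -(21/128) * evenCoeff 0 := by
  have h := evenCoeff_succ 1
  norm_num [evenCoeff_one] at h
  linarith

lemma oddCoeff_one : oddCoeff 1 = 5/24 * oddCoeff 0 := by
  have h := oddCoeff_succ 0
  norm_num at h
  linarith

lemma summable_evenCoeff_add_oddCoeff {x : ℝ} (hx0 : 0 ≤ x) (hx1 : x < 1) :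
    Summable fun k : ℕ => evenCoeff k * x ^ (2 * k) + oddCoeff k * x ^ (2 * k + 1) := by
  have hg : Summable fun k : ℕ => (x ^ 2) ^ k :=
    summable_geometric_of_lt_one (by positivity) (by nlinarith)
  refine Summable.add ?_ ?_
  · refine (summable_nat_add_iff 1).1 ?_
    refine Summable.of_norm_bounded (g := fun k : ℕ => -evenCoeff 1 * x ^ 2 * (x ^ 2) ^ k)
      (hg.mul_left _) fun k => ?_
    have hm : evenCoeff 1 ≤ evenCoeff (k + 1) := evenCoeff_succ_monotone k.zero_le
    rw [norm_mul, Real.norm_of_nonpos (evenCoeff_succ_nonpos k),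
      Real.norm_of_nonneg (by positivity), pow_mul, pow_succ', ← mul_assoc]
    gcongr
  · refine Summable.of_norm_bounded (g := fun k : ℕ => oddCoeff 0 * x * (x ^ 2) ^ k)
      (hg.mul_left _) fun k => ?_
    rw [norm_mul, Real.norm_of_nonneg (oddCoeff_nonneg k),
      Real.norm_of_nonneg (by positivity), pow_succ', pow_mul, ← mul_assoc]
    gcongr
    exact oddCoeff_antitone k.zero_le

theorem P_half_lower_bound (x : ℝ) (hx0 : 0 ≤ x) (hx : x ≤ 0.4) :
    (∑' k : ℕ,
        (-(Real.Gamma (3/4 + k) * Real.Gamma (-(1/4) + k)) /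
            (Real.Gamma (1/2 + k) * (k.factorial : ℝ)) * x ^ (2 * k) +
          Real.Gamma (1/4 + k) * Real.Gamma (5/4 + k) /
            (Real.Gamma (3/2 + k) * (k.factorial : ℝ)) * x ^ (2 * k + 1))) ≥
      8 * Real.pi ^ ((3:ℝ)/2) / Real.Gamma (1/4) ^ 2 +
        Real.Gamma (1/4) ^ 2 / (2 * Real.sqrt Real.pi) * x -
        3 * Real.pi ^ ((3:ℝ)/2) / Real.Gamma (1/4) ^ 2 * x ^ 2 := by
  change (∑' k : ℕ, (evenCoeff k * x ^ (2 * k) + oddCoeff k * x ^ (2 * k + 1))) ≥ _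
  have hx' : x ≤ 2/5 := by norm_num at hx ⊢; exact hx
  have hs := summable_evenCoeff_add_oddCoeff hx0 (by linarith)
  have hx2 : x ^ 2 ≤ 4/25 := by nlinarith
  have hg := (hasSum_geometric_of_lt_one (sq_nonneg x) (by linarith)).mul_left
    (evenCoeff 2 * x ^ 4)
  have htail := hasSum_le (fun k => ?_) hg ((summable_nat_add_iff 2).2 hs).hasSum
  · have hA : 0 ≤ evenCoeff 0 := by
      have := evenCoeff_succ_nonpos 0
      rw [zero_add, evenCoeff_one] at this
      linarith
    have hinv : (1 - x ^ 2)⁻¹ ≤ 25/21 := by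
      rw [inv_le_comm₀ (by linarith) (by norm_num)]
      linarith
    have hmain : 0 ≤ oddCoeff 1 * x ^ 3 + evenCoeff 2 * x ^ 4 * (1 - x ^ 2)⁻¹ := by
      have h1 : evenCoeff 0 * x ≤ 2 * oddCoeff 0 * (2/5) :=
        mul_le_mul evenCoeff_zero_le hx' hx0 (by linarith [oddCoeff_nonneg 0])
      have h2 := mul_le_mul_of_nonneg_left hinv (mul_nonneg hA hx0)
      have h3 : 0 ≤ x ^ 3 *
          (5/24 * oddCoeff 0 - 21/128 * (evenCoeff 0 * x * (1 - x ^ 2)⁻¹)) :=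
        mul_nonneg (by positivity) (by linarith [oddCoeff_nonneg 0])
      rw [oddCoeff_one, evenCoeff_two]
      linarith
    have hE : 3 * π ^ ((3 : ℝ)/2) / Real.Gamma (1/4) ^ 2 = -evenCoeff 1 := by
      rw [evenCoeff_one, evenCoeff_zero]
      ring
    rw [← hs.sum_add_tsum_nat_add 2, ← evenCoeff_zero, ← oddCoeff_zero, hE]
    simp only [Finset.sum_range_succ, Finset.sum_range_zero]
    norm_num
    linarith
  · have hm : evenCoeff 2 ≤ evenCoeff (k + 2) :=
      evenCoeff_succ_monotone (show 1 ≤ k + 1 by omega)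
    have ho := oddCoeff_nonneg (k + 2)
    calc evenCoeff 2 * x ^ 4 * (x ^ 2) ^ k = evenCoeff 2 * x ^ (2 * (k + 2)) := by ring
      _ ≤ evenCoeff (k + 2) * x ^ (2 * (k + 2)) := by gcongr
      _ ≤ _ := le_add_of_nonneg_right (by positivity)
end

section
/- For every x with 0 < x ≤ 0.4, one has (1/x) − δ_c·[ (1/x + 1)·(Γ(1/4)⁴ − 4π²x + (1/8)Γ(1/4)⁴x²)/(8π² + (1/2)Γ(1/4)⁴x − 3π²x²) + (1/x − 1)·(8π² − (1/2)Γ(1/4)⁴x + π²x²)/(Γ(1/4)⁴ − 12π²x − (3/8)Γ(1/4)⁴x²) ] ≥ 1 − 2δ_c. In particular both denominators are positive for such x. -/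
open Real

/-- A lower bound for `Γ(1/4)` coming from log-convexity of `Γ` on `[13/4, 17/4]`. -/
theorem Gamma_quarter_pow_four_gt : 150 < Real.Gamma (1/4) ^ 4 := by
  have hpos : 0 < Real.Gamma (1/4) := Real.Gamma_pos_of_pos (by norm_num)
  have h1 : Real.Gamma (5/4) = 1/4 * Real.Gamma (1/4) := by
    rw [← Real.Gamma_add_one (by norm_num)]; norm_num
  have h2 : Real.Gamma (9/4) = 5/4 * Real.Gamma (5/4) := by
    rw [← Real.Gamma_add_one (by norm_num)]; norm_num
  have h3 : Real.Gamma (13/4) = 9/4 * Real.Gamma (9/4) := by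
    rw [← Real.Gamma_add_one (by norm_num)]; norm_num
  have h4 : Real.Gamma (17/4) = 13/4 * Real.Gamma (13/4) := by
    rw [← Real.Gamma_add_one (by norm_num)]; norm_num
  have h6 : Real.Gamma 4 = 6 := by
    rw [show (4 : ℝ) = (3 : ℕ) + 1 by norm_num, Real.Gamma_nat_eq_factorial]
    norm_num [Nat.factorial]
  have hconv := Real.Gamma_mul_add_mul_le_rpow_Gamma_mul_rpow_Gamma
    (s := 13/4) (t := 17/4) (a := 1/4) (b := 3/4)
    (by norm_num) (by norm_num) (by norm_num) (by norm_num) (by norm_num)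
  rw [show (1/4 : ℝ) * (13/4) + 3/4 * (17/4) = 4 by norm_num, h6] at hconv
  have hs : 0 < Real.Gamma (13/4) := Real.Gamma_pos_of_pos (by norm_num)
  have ht : 0 < Real.Gamma (17/4) := Real.Gamma_pos_of_pos (by norm_num)
  have hpow := pow_le_pow_left₀ (by norm_num) hconv 4
  rw [mul_pow, ← Real.rpow_mul_natCast hs.le, ← Real.rpow_mul_natCast ht.le,
    show (1/4 : ℝ) * (4 : ℕ) = 1 by norm_num,
    show (3/4 : ℝ) * (4 : ℕ) = (3 : ℕ) by norm_num, Real.rpow_one, Real.rpow_natCast,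
    h4, h3, h2, h1] at hpow
  ring_nf at hpow ⊢
  linarith

theorem fifteen_mul_pi_sq_lt : 15 * Real.pi ^ 2 < Real.Gamma (1/4) ^ 4 := by
  have h := Gamma_quarter_pow_four_gt
  have hpi : Real.pi ^ 2 < 3.142 ^ 2 := by
    gcongr
    linarith [Real.pi_lt_d4]
  norm_num at hpi
  linarith

/-- The numerator obtained by clearing denominators, with `r = Γ(1/4)⁴ / π²`, is positive. -/
theorem numerator_pos {x r : ℝ} (hx0 : 0 < x) (hx : x ≤ 2/5) (hr : 15 ≤ r) :
    0 < (1/2 - 1/2 * x - 3/16 * x ^ 2 + 3/16 * x ^ 3) * r ^ 4 +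
      (-16 + 12 * x ^ 2 - 3/2 * x ^ 3 - 3/4 * x ^ 4) * r ^ 3 +
      (192 + 192 * x - 184 * x ^ 2 - 8 * x ^ 3 + 18 * x ^ 4) * r ^ 2 +
      (-2560 * x + 256 * x ^ 2 + 672 * x ^ 3 - 96 * x ^ 4) * r +
      (-6144 + 6144 * x + 2304 * x ^ 2 - 2304 * x ^ 3) := by
  obtain ⟨v, hv, rfl⟩ : ∃ v : ℝ, 0 ≤ v ∧ r = 15 + v := ⟨r - 15, by linarith, by ring⟩
  have hx2 : x ^ 2 ≤ 4/25 := by nlinarith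
  have hx2' : 0 < x ^ 2 := by positivity
  have hx3 : 0 < x ^ 3 := by positivity
  have hx4' : 0 < x ^ 4 := by positivity
  have hx4 : x ^ 4 ≤ 16/625 := by nlinarith
  have c0 : 0 < 16737/2 - 28737/2 * x - 67971/16 * x ^ 2 + 166491/16 * x ^ 3 + 315/4 * x ^ 4 := by
    linarith
  have c1 : 280 ≤ 1710 - 3550 * x + 1219/4 * x ^ 2 + 7803/4 * x ^ 3 - 249/4 * x ^ 4 := by
    linarith
  have c2 : -31 ≤ 147 - 483 * x + 823/8 * x ^ 2 + 1421/8 * x ^ 3 - 63/4 * x ^ 4 := by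
    nlinarith
  have c3 : 19/10 ≤ 14 - 30 * x + 3/4 * x ^ 2 + 39/4 * x ^ 3 - 3/4 * x ^ 4 := by
    linarith
  have c4 : 0 ≤ 1/2 - 1/2 * x - 3/16 * x ^ 2 + 3/16 * x ^ 3 := by
    linarith
  have t1 := mul_le_mul_of_nonneg_right c1 hv
  have t2 := mul_le_mul_of_nonneg_right c2 (pow_nonneg hv 2)
  have t3 := mul_le_mul_of_nonneg_right c3 (pow_nonneg hv 3)
  have t4 := mul_nonneg c4 (pow_nonneg hv 4)
  have t5 : 0 ≤ 280 * v - 31 * v ^ 2 + 19/10 * v ^ 3 := by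
    have : 0 ≤ v * (280 - 31 * v + 19/10 * v ^ 2) :=
      mul_nonneg hv (by nlinarith [sq_nonneg (v - 155/19)])
    linarith
  linarith

theorem denominators_pos {x r : ℝ} (hx0 : 0 < x) (hx : x ≤ 2/5) (hr : 15 ≤ r) :
    0 < 8 + 1/2 * r * x - 3 * x ^ 2 ∧ 0 < r - 12 * x - 3/8 * r * x ^ 2 := by
  have hx2 : x ^ 2 ≤ 4/25 := by nlinarith
  constructor
  · have : 0 ≤ r * x := by positivity
    linarith
  · nlinarith

theorem rational_bound_of_ratio {x r : ℝ} (hx0 : 0 < x) (hx : x ≤ 2/5) (hr : 15 ≤ r) :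
    1 - 2 * (8 * r / (r ^ 2 + 64)) ≤ 1 / x - 8 * r / (r ^ 2 + 64) *
      ((1 / x + 1) * (r - 4 * x + 1/8 * r * x ^ 2) / (8 + 1/2 * r * x - 3 * x ^ 2) +
        (1 / x - 1) * (8 - 1/2 * r * x + x ^ 2) / (r - 12 * x - 3/8 * r * x ^ 2)) := by
  obtain ⟨h1, h2⟩ := denominators_pos hx0 hx hr
  have hQ := numerator_pos hx0 hx hr
  have hS : 0 < r ^ 2 + 64 := by positivity
  rw [← sub_nonneg]
  have key : ∀ a b S : ℝ, a ≠ 0 → b ≠ 0 → S ≠ 0 →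
      1 / x - 8 * r / S * ((1 / x + 1) * (r - 4 * x + 1/8 * r * x ^ 2) / a +
        (1 / x - 1) * (8 - 1/2 * r * x + x ^ 2) / b) - (1 - 2 * (8 * r / S)) =
      (((1 - x) * S + 16 * r * x) * a * b - 8 * r * ((1 + x) * (r - 4 * x + 1/8 * r * x ^ 2) * b +
        (1 - x) * (8 - 1/2 * r * x + x ^ 2) * a)) / (x * (S * a * b)) := by
    intro a b S ha hb hS
    field_simp
    ring
  rw [key _ _ _ h1.ne' h2.ne' hS.ne']
  apply div_nonneg _ (by positivity)
  calc (0 : ℝ) ≤ x * ((1/2 - 1/2 * x - 3/16 * x ^ 2 + 3/16 * x ^ 3) * r ^ 4 +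
      (-16 + 12 * x ^ 2 - 3/2 * x ^ 3 - 3/4 * x ^ 4) * r ^ 3 +
      (192 + 192 * x - 184 * x ^ 2 - 8 * x ^ 3 + 18 * x ^ 4) * r ^ 2 +
      (-2560 * x + 256 * x ^ 2 + 672 * x ^ 3 - 96 * x ^ 4) * r +
      (-6144 + 6144 * x + 2304 * x ^ 2 - 2304 * x ^ 3)) := by positivity
    _ = _ := by ring

theorem rational_bound_small_x (x : ℝ) (hx0 : 0 < x) (hx : x ≤ 0.4) :
    0 < 8 * Real.pi ^ 2 + (1/2) * Real.Gamma (1/4) ^ 4 * x - 3 * Real.pi ^ 2 * x ^ 2 ∧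
    0 < Real.Gamma (1/4) ^ 4 - 12 * Real.pi ^ 2 * x - (3/8) * Real.Gamma (1/4) ^ 4 * x ^ 2 ∧
    1 / x - deltaC *
        ((1 / x + 1) *
            (Real.Gamma (1/4) ^ 4 - 4 * Real.pi ^ 2 * x + (1/8) * Real.Gamma (1/4) ^ 4 * x ^ 2) /
              (8 * Real.pi ^ 2 + (1/2) * Real.Gamma (1/4) ^ 4 * x - 3 * Real.pi ^ 2 * x ^ 2) +
          (1 / x - 1) *
            (8 * Real.pi ^ 2 - (1/2) * Real.Gamma (1/4) ^ 4 * x + Real.pi ^ 2 * x ^ 2) /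
              (Real.Gamma (1/4) ^ 4 - 12 * Real.pi ^ 2 * x -
                (3/8) * Real.Gamma (1/4) ^ 4 * x ^ 2)) ≥
      1 - 2 * deltaC := by
  have hpi : 0 < Real.pi ^ 2 := by positivity
  have hlt := fifteen_mul_pi_sq_lt
  obtain ⟨r, hr⟩ : ∃ r, Real.Gamma (1/4) ^ 4 = r * Real.pi ^ 2 :=
    ⟨Real.Gamma (1/4) ^ 4 / Real.pi ^ 2, by field_simp⟩
  unfold deltaC
  rw [hr] at hlt ⊢
  generalize Real.pi ^ 2 = p at *
  have hr15 : 15 ≤ r := (lt_of_mul_lt_mul_right hlt hpi.le).le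
  have hx' : x ≤ 2/5 := by norm_num at hx; exact hx
  have hr0 : 0 < r := by linarith
  obtain ⟨h1, h2⟩ := denominators_pos hx0 hx' hr15
  have e1 : 8 * p + 1/2 * (r * p) * x - 3 * p * x ^ 2 = p * (8 + 1/2 * r * x - 3 * x ^ 2) := by ring
  have e2 : r * p - 12 * p * x - 3/8 * (r * p) * x ^ 2 = p * (r - 12 * x - 3/8 * r * x ^ 2) := by
    ring
  have e3 : (1 / x + 1) * (r * p - 4 * p * x + 1/8 * (r * p) * x ^ 2) =
      p * ((1 / x + 1) * (r - 4 * x + 1/8 * r * x ^ 2)) := by ring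
  have e4 : (1 / x - 1) * (8 * p - 1/2 * (r * p) * x + p * x ^ 2) =
      p * ((1 / x - 1) * (8 - 1/2 * r * x + x ^ 2)) := by ring
  have e5 : (r * p / (8 * p) + 8 * p / (r * p))⁻¹ = 8 * r / (r ^ 2 + 64) := by
    field_simp
    ring
  rw [e1, e2, e3, e4, e5, mul_div_mul_left _ _ hpi.ne', mul_div_mul_left _ _ hpi.ne']
  exact ⟨mul_pos hpi h1, mul_pos hpi h2, rational_bound_of_ratio hx0 hx' hr15⟩
end

section
/- For every x with 0.4 ≤ x ≤ 1, one has (1/x) − δ_c·[ (1/x + 1)·(1 + (1/8)(1−x) + (9/128)(1−x)²)/(1 − (3/8)(1−x) − (15/128)(1−x)²) + (1/x − 1)·(1/3)·(1 + (1/16)(1−x) + (3/128)(1−x)²)/(1 − (3/16)(1−x) − (5/128)(1−x)²) ] ≥ 1 − 2δ_c. -/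
open Real

theorem gamma_add_nat_eq_prod_mul {s : ℝ} (hs : 0 < s) (n : ℕ) :
    Real.Gamma (s + n) = (∏ k ∈ Finset.range n, (s + k)) * Real.Gamma s := by
  induction n with
  | zero => simp
  | succ n ih =>
    have h : s + (n : ℝ) ≠ 0 := by positivity
    rw [Nat.cast_succ, ← add_assoc, Real.Gamma_add_one h, ih, Finset.prod_range_succ]
    ring

theorem factorial_pow_four_le_gamma (n : ℕ) :
    (n.factorial : ℝ) ^ 4 ≤ Real.Gamma (1/4 + n) ^ 4 * (1/4 + n) ^ 3 := by
  have hs : (0 : ℝ) < 1/4 + n := by positivity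
  have hG : 0 < Real.Gamma (1/4 + n) := Real.Gamma_pos_of_pos hs
  have hG' : 0 < Real.Gamma (1/4 + n + 1) := Real.Gamma_pos_of_pos (by positivity)
  have h := Real.Gamma_mul_add_mul_le_rpow_Gamma_mul_rpow_Gamma hs
    (by positivity : (0 : ℝ) < 1/4 + n + 1) (by norm_num : (0 : ℝ) < 1/4)
    (by norm_num : (0 : ℝ) < 3/4) (by norm_num)
  rw [show (1/4 : ℝ) * (1/4 + n) + 3/4 * (1/4 + n + 1) = n + 1 by ring,
    Real.Gamma_nat_eq_factorial] at h
  calc (n.factorial : ℝ) ^ 4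
      ≤ (Real.Gamma (1/4 + n) ^ (1/4 : ℝ) * Real.Gamma (1/4 + n + 1) ^ (3/4 : ℝ)) ^ 4 := by
        gcongr
    _ = Real.Gamma (1/4 + n) * Real.Gamma (1/4 + n + 1) ^ 3 := by
        rw [mul_pow, ← Real.rpow_mul_natCast hG.le, ← Real.rpow_mul_natCast hG'.le,
          ← Real.rpow_natCast _ 3]
        norm_num
    _ = Real.Gamma (1/4 + n) ^ 4 * (1/4 + n) ^ 3 := by
        rw [Real.Gamma_add_one hs.ne']
        ring

theorem le_gamma_quarter_pow_four : (168.5 : ℝ) ≤ Real.Gamma (1/4) ^ 4 := by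
  have h := factorial_pow_four_le_gamma 20
  rw [gamma_add_nat_eq_prod_mul (by norm_num), mul_pow] at h
  norm_num [Finset.prod_range_succ, Nat.factorial] at h ⊢
  linarith

theorem deltaC_nonneg : 0 ≤ deltaC := by
  unfold deltaC
  positivity

theorem deltaC_le : deltaC ≤ 0.385 := by
  have hg : 2.13 ≤ Real.Gamma (1/4) ^ 4 / (8 * Real.pi ^ 2) := by
    rw [le_div_iff₀ (by positivity)]
    have hpi : Real.pi ^ 2 ≤ 3.1416 ^ 2 := by
      gcongr
      exact Real.pi_lt_d4.le
    linarith [le_gamma_quarter_pow_four]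
  unfold deltaC
  rw [← inv_div (Real.Gamma (1/4) ^ 4)]
  set g := Real.Gamma (1/4) ^ 4 / (8 * Real.pi ^ 2)
  have hg0 : 0 < g := by linarith
  have hsum : 1 / 0.385 ≤ g + g⁻¹ := by
    have h : g + g⁻¹ = (g ^ 2 + 1) / g := by field_simp
    rw [h, le_div_iff₀ hg0]
    nlinarith
  rw [inv_le_comm₀ (by positivity) (by norm_num)]
  simpa using hsum

theorem rational_bound_large_x (x : ℝ) (hx0 : 0.4 ≤ x) (hx : x ≤ 1) :
    1 / x - deltaC *
        ((1 / x + 1) *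
            (1 + (1/8) * (1 - x) + (9/128) * (1 - x) ^ 2) /
              (1 - (3/8) * (1 - x) - (15/128) * (1 - x) ^ 2) +
          (1 / x - 1) * (1/3) *
            (1 + (1/16) * (1 - x) + (3/128) * (1 - x) ^ 2) /
              (1 - (3/16) * (1 - x) - (5/128) * (1 - x) ^ 2)) ≥
      1 - 2 * deltaC := by
  have hxpos : 0 < x := by linarith
  obtain ⟨y, rfl⟩ : ∃ y, x = 1 - y := ⟨1 - x, by ring⟩
  have hy0 : 0 ≤ y := by linarith
  have hy : y ≤ 0.6 := by linarith
  rw [sub_sub_cancel]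
  have hD₁ : 0 < 1 - (3/8) * y - (15/128) * y ^ 2 := by nlinarith
  have hD₂ : 0 < 1 - (3/16) * y - (5/128) * y ^ 2 := by nlinarith
  have hA : (2 - y) * ((1 + (1/8) * y + (9/128) * y ^ 2) /
      (1 - (3/8) * y - (15/128) * y ^ 2)) ≤ 2 + 0.19 * y := by
    rw [← mul_div_assoc, div_le_iff₀ hD₁]
    have h : 0 ≤ 0.19 * (1 - (3/8) * y - (15/128) * y ^ 2) - y * (32 - 9 * y) / 128 := by
      nlinarith
    linarith [mul_nonneg hy0 h]
  have hB : (1 + (1/16) * y + (3/128) * y ^ 2) / (1 - (3/16) * y - (5/128) * y ^ 2) ≤ 1.2 := by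
    rw [div_le_iff₀ hD₂]
    nlinarith
  set A := (1 + (1/8) * y + (9/128) * y ^ 2) / (1 - (3/8) * y - (15/128) * y ^ 2)
  set B := (1 + (1/16) * y + (3/128) * y ^ 2) / (1 - (3/16) * y - (5/128) * y ^ 2)
  have hbracket : (2 - y) * A + y * (1/3) * B - 2 * (1 - y) ≤ 2.59 * y := by
    linarith [mul_le_mul_of_nonneg_left hB hy0]
  have hmain : deltaC * ((2 - y) * A + y * (1/3) * B - 2 * (1 - y)) ≤ y := by
    calc _ ≤ deltaC * (2.59 * y) := mul_le_mul_of_nonneg_left hbracket deltaC_nonneg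
      _ ≤ 0.385 * (2.59 * y) := mul_le_mul_of_nonneg_right deltaC_le (by positivity)
      _ ≤ y := by linarith
  rw [mul_div_assoc, mul_div_assoc, ge_iff_le, ← sub_nonneg]
  have h : 1 / (1 - y) - deltaC * ((1 / (1 - y) + 1) * A + (1 / (1 - y) - 1) * (1/3) * B) -
      (1 - 2 * deltaC) =
      (y - deltaC * ((2 - y) * A + y * (1/3) * B - 2 * (1 - y))) / (1 - y) := by
    field_simp
    ring
  rw [h]
  exact div_nonneg (by linarith) hxpos.le
end
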